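/- arXiv:2504.11916 — 5 statements merged into one kernel-verified Lean document; each statement's English description precedes it below -/
import Mathlib

section
/- For every ε > 0 there exists C > 0 such that for every integer q ≥ 1 and all integers γ, μ, one has | ∑_{s mod q, gcd(s,q)=1} e_q(γ s̄² + μ s) | ≤ C gcd(γ, μ, q)^{1/2} q^{1/2 + ε}, where s̄ denotes the multiplicative inverse of s modulo q and gcd(γ,μ,q) is the greatest common divisor of γ, μ and q. -/
/-- `e_q(x) = exp(2πi x / q)`. -/
noncomputable def eInt (q : ℕ) (x : ℤ) : ℂ := Complex.exp (2 * Real.pi * Complex.I * x / q)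

/-- A natural-number representative of the multiplicative inverse of `x` modulo `q`. -/
noncomputable def invMod (q : ℕ) (x : ℤ) : ℕ := (((x : ZMod q))⁻¹).val

section PolynomialMethod

open Polynomial

/-- A family of polynomials with more members than a common degree bound is linearly dependent. -/
theorem exists_relation_of_natDegree_lt {k : Type*} [Field k] {N M : ℕ} (hMN : M < N)
    (R : ℕ → k[X]) (hR : ∀ n < N, R n ∈ degreeLT k M) :
    ∃ a : ℕ → k, (∃ n < N, a n ≠ 0) ∧ ∑ n ∈ Finset.range N, C (a n) * R n = 0 := by
  have hfin : Module.finrank k (degreeLT k M) = M := by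
    rw [(degreeLTEquiv k M).finrank_eq]; simp
  have : FiniteDimensional k (degreeLT k M) := (degreeLTEquiv k M).symm.finiteDimensional
  have hdep : ¬ LinearIndependent k (fun n : Fin N => (⟨R n, hR n n.2⟩ : degreeLT k M)) := by
    intro h
    have := h.fintype_card_le_finrank
    rw [hfin, Fintype.card_fin] at this
    omega
  rw [Fintype.not_linearIndependent_iff] at hdep
  obtain ⟨g, hg, i, hi⟩ := hdep
  refine ⟨fun n => if h : n < N then g ⟨n, h⟩ else 0, ⟨i, i.2, by simpa using hi⟩, ?_⟩
  rw [Finset.sum_range]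
  have := congrArg Subtype.val hg
  simpa [Polynomial.smul_eq_C_mul] using this

/-- A nontrivial combination of polynomials of strictly increasing degrees is nonzero. -/
theorem sum_ne_zero_of_natDegree_strictMono {k : Type*} [Field k] {N D : ℕ} (B : ℕ → k[X])
    (hB0 : ∀ n < N, B n ≠ 0) (hB : ∀ n < N, (B n).natDegree = n + D) (a : ℕ → k)
    (ha : ∃ n < N, a n ≠ 0) :
    ∑ n ∈ Finset.range N, C (a n) * B n ≠ 0 := by
  classical
  obtain ⟨n₀, hn₀, ha₀⟩ := ha
  let s := (Finset.range N).filter (fun n => a n ≠ 0)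
  have hs : s.Nonempty := ⟨n₀, by simp [s, hn₀, ha₀]⟩
  obtain ⟨m, hms, hmax⟩ := s.exists_max_image id hs
  simp only [s, Finset.mem_filter, Finset.mem_range, id] at hms hmax
  intro h
  have hc := congrArg (fun f => f.coeff (m + D)) h
  simp only [finsetSum_coeff, coeff_C_mul, coeff_zero] at hc
  rw [Finset.sum_eq_single m] at hc
  · have : (B m).coeff (m + D) ≠ 0 := by
      rw [← hB m hms.1]; simpa using hB0 m hms.1
    exact (mul_ne_zero hms.2 this) hc
  · intro n hn hnm
    rw [Finset.mem_range] at hn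
    by_cases han : a n = 0
    · simp [han]
    · have := hmax n ⟨hn, han⟩
      rw [coeff_eq_zero_of_natDegree_lt, mul_zero]
      rw [hB n hn]; omega
  · simp [hms.1]

/-- Stepanov's method for the equation `t + t ^ P = c`, where `t = U / x ^ (2 Q)` and `P = p Q`. -/
theorem card_le_of_artinSchreier_relation {p : ℕ} [Fact p.Prime] {F : Type*} [Field F]
    [Algebra (ZMod p) F] {r : ℕ} (hr : 2 ≤ r) {U : (ZMod p)[X]} (hU : U.natDegree = 3 * p ^ r)
    (c : ZMod p) (S : Finset F) (hS0 : ∀ x ∈ S, x ≠ 0)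
    (hSq : ∀ x ∈ S, x ^ (p ^ (r + 1) * p ^ (r + 1)) = x)
    (hS : ∀ x ∈ S, (aeval x U) ^ p ^ (r + 1) * x ^ (2 * p ^ r) =
      x ^ (2 * p ^ r * p ^ (r + 1)) * (algebraMap _ F c * x ^ (2 * p ^ r) - aeval x U)) :
    S.card ≤ p ^ (r + 1) * p ^ r + 5 * p ^ (r + 1) := by
  classical
  have hp : p.Prime := Fact.out
  have : CharP F p := charP_of_injective_algebraMap (algebraMap (ZMod p) F).injective p
  have : ExpChar F p := ExpChar.prime hp
  have hp2 := hp.two_le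
  have hPQ : p ^ (r + 1) = p * p ^ r := by ring
  have hQ4 : 4 ≤ p ^ r := by
    calc 4 = 2 ^ 2 := by norm_num
      _ ≤ p ^ 2 := Nat.pow_le_pow_left hp2 2
      _ ≤ p ^ r := Nat.pow_le_pow_right hp.pos hr
  have hfrob : ∀ (s : Finset ℕ) (f : ℕ → F), (∑ n ∈ s, f n) ^ p ^ (r + 1) =
      ∑ n ∈ s, f n ^ p ^ (r + 1) := fun s f => sum_pow_char_pow p (r + 1) s f
  have hconst : ∀ a : ZMod p, (algebraMap _ F a) ^ p ^ (r + 1) = algebraMap _ F a := by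
    intro a; rw [← map_pow, ZMod.pow_card_pow]
  generalize hP : p ^ (r + 1) = P at *
  generalize hQ : p ^ r = Q at *
  have hU0 : U ≠ 0 := by
    rintro rfl; simp at hU; omega
  set B : ℕ → (ZMod p)[X] := fun n =>
    X ^ (n % Q + P * (n / P)) * U ^ (n / Q % p) * X ^ (2 * Q * (p - 1 - n / Q % p)) with hB
  set R : ℕ → (ZMod p)[X] := fun n =>
    X ^ (P * (n % Q) + n / P) * (C c * X ^ (2 * Q) - U) ^ (n / Q % p) *
      X ^ (2 * Q * (p - 1 - n / Q % p)) with hR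
  have hl : ∀ n, n / Q % p ≤ p - 1 := fun n => by have := Nat.mod_lt (n / Q) hp.pos; omega
  have hdecomp : ∀ n, n % Q + Q * (n / Q % p) + P * (n / P) = n := by
    intro n
    have h1 := Nat.mod_add_div n Q
    have h2 := Nat.mod_add_div (n / Q) p
    rw [Nat.div_div_eq_div_mul, mul_comm Q p, ← hPQ] at h2
    calc n % Q + Q * (n / Q % p) + P * (n / P) = n % Q + Q * (n / Q % p + p * (n / P)) := by
          rw [hPQ]; ring
      _ = n := by rw [h2, h1]
  have hB0 : ∀ n, B n ≠ 0 := fun n =>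
    mul_ne_zero (mul_ne_zero (pow_ne_zero _ X_ne_zero) (pow_ne_zero _ hU0))
      (pow_ne_zero _ X_ne_zero)
  have hBdeg : ∀ n, (B n).natDegree = n + 2 * Q * (p - 1) := by
    intro n
    simp only [hB]
    rw [natDegree_mul (mul_ne_zero (pow_ne_zero _ X_ne_zero) (pow_ne_zero _ hU0))
      (pow_ne_zero _ X_ne_zero), natDegree_mul (pow_ne_zero _ X_ne_zero) (pow_ne_zero _ hU0)]
    simp only [natDegree_pow, natDegree_X, hU]
    have := hl n
    obtain ⟨e, he⟩ := Nat.exists_eq_add_of_le this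
    rw [he, Nat.add_sub_cancel_left]
    linarith [hdecomp n]
  set K := Q + 3 with hK
  have hRdeg : ∀ n < P * K, R n ∈ degreeLT (ZMod p) (P * Q + 2 * P + K) := by
    intro n hn
    rw [mem_degreeLT]
    refine lt_of_le_of_lt degree_le_natDegree ?_
    rw [Nat.cast_lt]
    have h1 : (C c * X ^ (2 * Q) - U).natDegree ≤ 3 * Q := by
      refine (natDegree_sub_le _ _).trans (max_le ((natDegree_C_mul_X_pow_le _ _).trans ?_) hU.le)
      omega
    have h2 : (R n).natDegree ≤ (P * (n % Q) + n / P) + (n / Q % p) * (3 * Q) +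
        2 * Q * (p - 1 - n / Q % p) := by
      simp only [hR]
      refine natDegree_mul_le.trans ?_
      refine add_le_add (natDegree_mul_le.trans ?_) (by simp)
      exact add_le_add (by simp) (natDegree_pow_le_of_le _ h1)
    refine h2.trans_lt ?_
    have h3 : n / P < K := Nat.div_lt_of_lt_mul hn
    have h4 : n % Q + 1 ≤ Q := Nat.mod_lt _ (by omega)
    obtain ⟨e, he⟩ := Nat.exists_eq_add_of_le (hl n)
    have h5 : p = n / Q % p + e + 1 := by omega
    rw [he, Nat.add_sub_cancel_left]
    generalize n / Q % p = l at *
    generalize n % Q = i at *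
    generalize n / P = k at *
    subst h5
    nlinarith
  have hlt : P * Q + 2 * P + K < P * K := by
    have : 2 * Q ≤ P := by rw [hPQ]; exact Nat.mul_le_mul_right _ hp2
    rw [hK]; nlinarith
  obtain ⟨a, ha, hrel⟩ := exists_relation_of_natDegree_lt hlt R hRdeg
  have hG := sum_ne_zero_of_natDegree_strictMono B (fun n _ => hB0 n) (fun n _ => hBdeg n) a ha
  set G := ∑ n ∈ Finset.range (P * K), C (a n) * B n with hGdef
  have hroot : ∀ x ∈ S, aeval x G = 0 := by
    intro x hx
    have hx0 := hS0 x hx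
    have hPne : P ≠ 0 := by rw [← hP]; positivity
    have key : (aeval x G) ^ P * x ^ (2 * Q * (p - 1)) = 0 := by
      have h0 : x ^ (2 * Q * P * (p - 1)) *
          aeval x (∑ n ∈ Finset.range (P * K), C (a n) * R n) = 0 := by
        rw [hrel]; simp
      rw [← h0, hGdef, map_sum, map_sum, hfrob, Finset.sum_mul, Finset.mul_sum]
      refine Finset.sum_congr rfl fun n _ => ?_
      obtain ⟨e, he⟩ := Nat.exists_eq_add_of_le (hl n)
      simp only [hB, hR, map_mul, map_pow, map_sub, aeval_X, aeval_C, he, Nat.add_sub_cancel_left]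
      have h1 := congrArg (· ^ (n / Q % p)) (hS x hx)
      have h2 := congrArg (· ^ (n / P)) (hSq x hx)
      simp only [mul_pow, ← pow_mul] at h1 h2
      generalize n / Q % p = l at *
      generalize n % Q = i at *
      generalize n / P = k at *
      simp only [mul_pow, hconst]
      generalize (aeval x U) = u at *
      calc algebraMap (ZMod p) F (a n) * ((x ^ (i + P * k)) ^ P * (u ^ l) ^ P *
            (x ^ (2 * Q * e)) ^ P) * x ^ (2 * Q * (l + e))
          = algebraMap (ZMod p) F (a n) * (x ^ (P * i) * x ^ (P * P * k) *
            (u ^ (P * l) * x ^ (2 * Q * l)) * x ^ (2 * Q * e * P) * x ^ (2 * Q * e)) := by ring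
        _ = _ := by rw [h1, h2]; ring
    rcases mul_eq_zero.1 key with h | h
    · exact pow_eq_zero_iff hPne |>.1 h
    · exact absurd h (pow_ne_zero _ hx0)
  have hcard : S.card ≤ G.natDegree := by
    have hGm : G.map (algebraMap (ZMod p) F) ≠ 0 := by
      rwa [Polynomial.map_ne_zero_iff (algebraMap (ZMod p) F).injective]
    rw [← natDegree_map (algebraMap (ZMod p) F)]
    refine (Finset.card_le_card (fun x hx => ?_)).trans
      ((Multiset.toFinset_card_le _).trans (card_roots' _))
    rw [Multiset.mem_toFinset, mem_roots hGm, IsRoot, eval_map_algebraMap]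
    exact hroot x hx
  refine hcard.trans ?_
  have hGdeg : G.natDegree ≤ P * K + 2 * Q * (p - 1) := by
    refine natDegree_sum_le_of_forall_le _ _ fun n hn => ?_
    refine (natDegree_C_mul_le _ _).trans ?_
    rw [hBdeg]
    have := Finset.mem_range.1 hn
    omega
  refine hGdeg.trans ?_
  obtain ⟨e, he⟩ := Nat.exists_eq_add_of_le hp.one_le
  rw [hK, he, Nat.add_sub_cancel_left]
  have : P = Q + e * Q := by rw [hPQ, he]; ring
  nlinarith

/-- The number of nonzero `x` in a finite field of even degree over `ZMod p` for which
`μ x + γ x⁻²` has prescribed trace. -/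
theorem card_trace_eq_le {p : ℕ} [Fact p.Prime] {F : Type*} [Field F] [Fintype F] [DecidableEq F]
    [Algebra (ZMod p) F] {r : ℕ} (hr : 2 ≤ r) (hF : Fintype.card F = p ^ (2 * (r + 1)))
    {μ : ZMod p} (hμ : μ ≠ 0) (γ c : ZMod p) :
    (Finset.univ.filter fun x : F => x ≠ 0 ∧
      Algebra.trace (ZMod p) F (algebraMap _ F μ * x + algebraMap _ F γ * (x⁻¹) ^ 2) = c).card ≤
      p ^ (r + 1) * p ^ r + 5 * p ^ (r + 1) := by
  have hp : p.Prime := Fact.out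
  have : CharP F p := charP_of_injective_algebraMap (algebraMap (ZMod p) F).injective p
  have : ExpChar F p := ExpChar.prime hp
  set U : (ZMod p)[X] := ∑ i ∈ Finset.range (r + 1),
    (C μ * X ^ (2 * p ^ r + p ^ i) + C γ * X ^ (2 * p ^ r - 2 * p ^ i)) with hUdef
  have hpow : ∀ i < r, p ^ i < p ^ r := fun i hi => Nat.pow_lt_pow_right hp.one_lt hi
  have hU : U.natDegree = 3 * p ^ r := by
    have hpos : 0 < p ^ r := pow_pos hp.pos r
    rw [hUdef, Finset.sum_range_succ, ← add_assoc, add_right_comm,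
      show 2 * p ^ r + p ^ r = 3 * p ^ r by ring]
    rw [natDegree_add_eq_right_of_natDegree_lt]
    · exact natDegree_C_mul_X_pow _ _ hμ
    · rw [natDegree_C_mul_X_pow _ _ hμ]
      rw [Nat.lt_iff_le_pred (by omega)]
      refine natDegree_add_le_of_degree_le (natDegree_sum_le_of_forall_le _ _ fun i hi => ?_) ?_
      · have := hpow i (Finset.mem_range.1 hi)
        refine natDegree_add_le_of_degree_le ?_ ?_ <;>
          refine (natDegree_C_mul_X_pow_le _ _).trans ?_ <;> omega
      · refine (natDegree_C_mul_X_pow_le _ _).trans ?_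
        omega
  have hcard : Nat.card F = p ^ (2 * (r + 1)) := by rw [Nat.card_eq_fintype_card, hF]
  have hfin : Module.finrank (ZMod p) F = 2 * (r + 1) := by
    have := Module.card_eq_pow_finrank (K := ZMod p) (V := F)
    rw [hF, ZMod.card] at this
    exact (Nat.pow_right_injective hp.two_le this).symm
  refine card_le_of_artinSchreier_relation hr hU c _ (fun x hx => (Finset.mem_filter.1 hx).2.1)
    (fun x _ => ?_) (fun x hx => ?_)
  · rw [← pow_add, ← two_mul, ← hF, FiniteField.pow_card]
  · obtain ⟨-, hx0, hx⟩ := Finset.mem_filter.1 hx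
    set f := algebraMap _ F μ * x + algebraMap _ F γ * (x⁻¹) ^ 2 with hf
    have hconst : ∀ (a : ZMod p) (i : ℕ), (algebraMap _ F a) ^ p ^ i = algebraMap _ F a := by
      intro a i; rw [← map_pow, ZMod.pow_card_pow]
    have hUx : aeval x U = x ^ (2 * p ^ r) * ∑ i ∈ Finset.range (r + 1), f ^ p ^ i := by
      rw [hUdef, map_sum, Finset.mul_sum]
      refine Finset.sum_congr rfl fun i hi => ?_
      have hle : p ^ i ≤ p ^ r :=
        Nat.pow_le_pow_right hp.pos (Nat.lt_succ_iff.1 (Finset.mem_range.1 hi))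
      have h2 : x ^ (2 * p ^ r) = x ^ (2 * p ^ r - 2 * p ^ i) * x ^ (2 * p ^ i) := by
        rw [← pow_add]; congr 1; omega
      rw [hf, add_pow_char_pow, mul_pow, mul_pow, hconst, hconst]
      simp only [map_add, map_mul, map_pow, aeval_C, aeval_X]
      rw [mul_add]
      congr 1
      · ring
      · rw [h2, ← pow_mul, inv_pow]
        field_simp
    have htr : algebraMap _ F c = ∑ i ∈ Finset.range (r + 1), f ^ p ^ i +
        (∑ i ∈ Finset.range (r + 1), f ^ p ^ i) ^ p ^ (r + 1) := by
      rw [← hx, FiniteField.algebraMap_trace_eq_sum_pow, hfin, Nat.card_zmod, two_mul,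
        Finset.sum_range_add, sum_pow_char_pow]
      congr 1
      refine Finset.sum_congr rfl fun i _ => ?_
      rw [← pow_mul, ← pow_add, add_comm]
    rw [hUx, htr]
    ring

/-- Square-root cancellation, up to a constant depending on `p`, over fields of even degree. -/
theorem norm_sum_trace_le {p : ℕ} [Fact p.Prime] {F : Type*} [Field F] [Fintype F] [DecidableEq F]
    [Algebra (ZMod p) F] {r : ℕ} (hr : 2 ≤ r) (hF : Fintype.card F = p ^ (2 * (r + 1)))
    {μ : ZMod p} (hμ : μ ≠ 0) (γ : ZMod p) {ψ : AddChar (ZMod p) ℂ} (hψ : ψ ≠ 1) :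
    ‖∑ x : F with x ≠ 0, ψ (Algebra.trace (ZMod p) F
      (algebraMap _ F μ * x + algebraMap _ F γ * (x⁻¹) ^ 2))‖ ≤ 6 * p * (p : ℝ) ^ (r + 1) := by
  have hp : p.Prime := Fact.out
  set T : F → ZMod p := fun x => Algebra.trace (ZMod p) F
      (algebraMap _ F μ * x + algebraMap _ F γ * (x⁻¹) ^ 2) with hT
  set N : ZMod p → ℕ := fun c => (Finset.univ.filter fun x : F => x ≠ 0 ∧ T x = c).card with hN
  set A : ℕ := p ^ (r + 1) * p ^ r + 5 * p ^ (r + 1) with hA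
  have hNA : ∀ c, N c ≤ A := fun c => card_trace_eq_le hr hF hμ γ c
  have hsum : ∑ x : F with x ≠ 0, ψ (T x) = ∑ c : ZMod p, (N c : ℂ) * ψ c := by
    rw [← Finset.sum_fiberwise (g := T)]
    refine Finset.sum_congr rfl fun c _ => ?_
    rw [Finset.sum_congr rfl (g := fun _ => ψ c) (fun x hx => by rw [(Finset.mem_filter.1 hx).2])]
    rw [Finset.sum_const, nsmul_eq_mul, Finset.filter_filter]
  have hNsum : ∑ c, N c + 1 = p ^ (2 * (r + 1)) := by
    rw [← hF, ← Finset.card_univ, ← Finset.card_erase_add_one (Finset.mem_univ (0 : F))]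
    congr 1
    rw [Finset.card_eq_sum_card_fiberwise (f := T) (t := Finset.univ) (fun _ _ => by simp)]
    refine Finset.sum_congr rfl fun c _ => ?_
    simp only [hN]
    congr 1
    ext x; simp
  have hzero : ∑ c : ZMod p, ψ c = 0 := AddChar.sum_eq_zero_of_ne_one hψ
  have hrew : ∑ c : ZMod p, (N c : ℂ) * ψ c = -∑ c : ZMod p, ((A - N c : ℕ) : ℂ) * ψ c := by
    rw [← Finset.sum_neg_distrib, ← sub_eq_zero, ← Finset.sum_sub_distrib]
    rw [← mul_zero (A : ℂ), ← hzero, Finset.mul_sum]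
    refine Finset.sum_congr rfl fun c _ => ?_
    rw [Nat.cast_sub (hNA c)]; ring
  rw [hsum, hrew, norm_neg]
  have h1 : ‖∑ c : ZMod p, ((A - N c : ℕ) : ℂ) * ψ c‖ ≤ ∑ c : ZMod p, ((A - N c : ℕ) : ℝ) := by
    refine norm_sum_le_of_le _ fun c _ => ?_
    rw [norm_mul, AddChar.norm_apply, mul_one, Complex.norm_natCast]
  refine h1.trans ?_
  have h2 : ∑ c : ZMod p, (A - N c : ℕ) + ∑ c, N c = p * A := by
    rw [← Finset.sum_add_distrib, Finset.sum_congr rfl (g := fun _ => A)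
      (fun c _ => Nat.sub_add_cancel (hNA c))]
    simp [ZMod.card]
  have h3 : ∑ c : ZMod p, (A - N c : ℕ) ≤ 6 * p * p ^ (r + 1) := by
    have h4 : p * A = p ^ (2 * (r + 1)) + 5 * p * p ^ (r + 1) := by rw [hA]; ring
    have h5 : 1 ≤ p * p ^ (r + 1) := Nat.one_le_iff_ne_zero.2 (by have := hp.pos; positivity)
    nlinarith
  exact_mod_cast h3

section EulerProduct

variable (k : Type*) [Field k] [Finite k]

theorem finite_monic_natDegree_eq (d : ℕ) : {g : k[X] | g.Monic ∧ g.natDegree = d}.Finite := by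
  have : Finite (degreeLT k (d + 1)) := Finite.of_equiv _ (degreeLTEquiv k (d + 1)).symm.toEquiv
  refine (Set.toFinite (degreeLT k (d + 1) : Set k[X])).subset fun g hg => ?_
  rw [SetLike.mem_coe, mem_degreeLT]
  refine degree_le_natDegree.trans_lt ?_
  rw [hg.2]
  exact_mod_cast Nat.lt_succ_self d

/-- The monic polynomials of degree `d` over a finite field. -/
noncomputable def monicsOfDegree (d : ℕ) : Finset k[X] := (finite_monic_natDegree_eq k d).toFinset

variable {k}

theorem mem_monicsOfDegree {d : ℕ} {g : k[X]} :
    g ∈ monicsOfDegree k d ↔ g.Monic ∧ g.natDegree = d := by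
  simp [monicsOfDegree]

variable (k) in
/-- The monic irreducible polynomials of degree at most `d` over a finite field. -/
noncomputable def monicIrreducibles (d : ℕ) : Finset k[X] := by
  classical exact ((Finset.range (d + 1)).biUnion (monicsOfDegree k)).filter Irreducible

theorem mem_monicIrreducibles {d : ℕ} {g : k[X]} :
    g ∈ monicIrreducibles k d ↔ g.Monic ∧ g.natDegree ≤ d ∧ Irreducible g := by
  simp only [monicIrreducibles, Finset.mem_filter, Finset.mem_biUnion, Finset.mem_range,
    mem_monicsOfDegree, Nat.lt_succ_iff]
  constructor
  · rintro ⟨⟨e, he, hg, rfl⟩, hi⟩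
    exact ⟨hg, he, hi⟩
  · rintro ⟨hg, he, hi⟩
    exact ⟨⟨_, he, hg, rfl⟩, hi⟩

open Classical in
/-- The degree of a monic polynomial, counted through its irreducible factors. -/
theorem natDegree_eq_sum_monicIrreducibles {d : ℕ} {g : k[X]} (hg : g.Monic)
    (hd : g.natDegree = d) :
    g.natDegree = ∑ P ∈ monicIrreducibles k d, ∑ j ∈ Finset.Icc 1 d,
      if P ^ j ∣ g then P.natDegree else 0 := by
  have hg0 := hg.ne_zero
  set m := UniqueFactorizationMonoid.normalizedFactors g with hm
  have hmem : ∀ P ∈ m, Irreducible P ∧ P.Monic ∧ P ∣ g := by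
    intro P hP
    have hirr := UniqueFactorizationMonoid.irreducible_of_normalized_factor P hP
    refine ⟨hirr, ?_, UniqueFactorizationMonoid.dvd_of_mem_normalizedFactors hP⟩
    have := UniqueFactorizationMonoid.normalize_normalized_factor P hP
    rw [← this]
    exact monic_normalize hirr.ne_zero
  have hprod : m.prod = g := by
    rw [hm, UniqueFactorizationMonoid.prod_normalizedFactors_eq hg0, hg.normalize_eq_self]
  have hcount : ∀ P : k[X], P.Monic → Irreducible P → ∀ j, P ^ j ∣ g ↔ j ≤ m.count P := by
    intro P hPm hP j
    rw [pow_dvd_iff_le_emultiplicity,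
      UniqueFactorizationMonoid.emultiplicity_eq_count_normalizedFactors hP hg0,
      hPm.normalize_eq_self, Nat.cast_le]
  have h1 : g.natDegree = ∑ P ∈ m.toFinset, m.count P * P.natDegree := by
    conv_lhs => rw [← hprod]
    rw [← Multiset.map_id m, natDegree_multiset_prod_of_monic]
    · simp only [Multiset.map_id, Finset.sum_multiset_map_count, smul_eq_mul]
    · simpa using fun P hP => (hmem P hP).2.1
  have hsub : m.toFinset ⊆ monicIrreducibles k d := by
    intro P hP
    obtain ⟨hi, hPm, hdvd⟩ := hmem P (Multiset.mem_toFinset.1 hP)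
    exact mem_monicIrreducibles.2 ⟨hPm, hd ▸ natDegree_le_of_dvd hdvd hg0, hi⟩
  rw [h1, Finset.sum_subset hsub (fun P _ hP => by
    rw [Multiset.mem_toFinset] at hP; rw [Multiset.count_eq_zero_of_notMem hP, zero_mul])]
  refine Finset.sum_congr rfl fun P hP => ?_
  obtain ⟨hPm, -, hi⟩ := mem_monicIrreducibles.1 hP
  rw [← Finset.sum_filter, Finset.sum_const, smul_eq_mul]
  congr 1
  have hle : m.count P ≤ d := by
    have h2 : P ^ m.count P ∣ g := (hcount P hPm hi _).2 le_rfl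
    have h3 := natDegree_le_of_dvd h2 hg0
    rw [natDegree_pow, hd] at h3
    exact (Nat.le_mul_of_pos_right _ hi.natDegree_pos).trans h3
  rw [Finset.filter_congr (q := fun j => j ≤ m.count P) (fun j _ => hcount P hPm hi j)]
  have : (Finset.Icc 1 d).filter (fun j => j ≤ m.count P) = Finset.Icc 1 (m.count P) := by
    ext j; simp only [Finset.mem_filter, Finset.mem_Icc]; omega
  rw [this]; simp

/-- The `m`-th logarithmic coefficient of the `L`-function of a multiplicative function `χ` on
monic polynomials. -/
noncomputable def primePowerSum (χ : k[X] → ℂ) (m : ℕ) : ℂ :=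
  ∑ P ∈ monicIrreducibles k m with P.natDegree ∣ m,
    (P.natDegree : ℂ) * χ (P ^ (m / P.natDegree))

theorem sum_filter_dvd_monicsOfDegree {χ : k[X] → ℂ}
    (hχ : ∀ g h : k[X], g.Monic → h.Monic → χ (g * h) = χ g * χ h) {Q : k[X]} (hQ : Q.Monic)
    {d : ℕ} (hd : Q.natDegree ≤ d) [DecidablePred fun g => Q ∣ g] :
    ∑ g ∈ monicsOfDegree k d with Q ∣ g, χ g =
      χ Q * ∑ h ∈ monicsOfDegree k (d - Q.natDegree), χ h := by
  rw [Finset.mul_sum]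
  symm
  refine Finset.sum_bij (fun h _ => Q * h) ?_ ?_ ?_ ?_
  · intro h hh
    obtain ⟨hm, hdeg⟩ := mem_monicsOfDegree.1 hh
    refine Finset.mem_filter.2 ⟨mem_monicsOfDegree.2 ⟨hQ.mul hm, ?_⟩, dvd_mul_right _ _⟩
    rw [hQ.natDegree_mul hm, hdeg]; omega
  · intro a _ b _ hab
    exact mul_left_cancel₀ hQ.ne_zero hab
  · intro g hg
    obtain ⟨hg1, h, rfl⟩ := Finset.mem_filter.1 hg
    obtain ⟨hm, hdeg⟩ := mem_monicsOfDegree.1 hg1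
    have hh : h.Monic := hQ.of_mul_monic_left hm
    refine ⟨h, mem_monicsOfDegree.2 ⟨hh, ?_⟩, rfl⟩
    rw [hQ.natDegree_mul hh] at hdeg; omega
  · intro h hh
    exact (hχ Q h hQ (mem_monicsOfDegree.1 hh).1).symm

/-- Newton's identities for the `L`-function of a multiplicative function on monic polynomials. -/
theorem natCast_mul_sum_monicsOfDegree {χ : k[X] → ℂ}
    (hχ : ∀ g h : k[X], g.Monic → h.Monic → χ (g * h) = χ g * χ h) (d : ℕ) :
    (d : ℂ) * ∑ g ∈ monicsOfDegree k d, χ g =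
      ∑ m ∈ Finset.Icc 1 d, primePowerSum χ m * ∑ h ∈ monicsOfDegree k (d - m), χ h := by
  classical
  set A : ℕ → ℂ := fun d => ∑ g ∈ monicsOfDegree k d, χ g with hA
  have hL : (d : ℂ) * A d = ∑ P ∈ monicIrreducibles k d, ∑ j ∈ Finset.Icc 1 d,
      if j * P.natDegree ≤ d then (P.natDegree : ℂ) * (χ (P ^ j) * A (d - j * P.natDegree))
      else 0 := by
    calc (d : ℂ) * A d = ∑ g ∈ monicsOfDegree k d, ((g.natDegree : ℕ) : ℂ) * χ g := by
          rw [hA, Finset.mul_sum]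
          exact Finset.sum_congr rfl fun g hg => by rw [(mem_monicsOfDegree.1 hg).2]
      _ = ∑ g ∈ monicsOfDegree k d, ∑ P ∈ monicIrreducibles k d, ∑ j ∈ Finset.Icc 1 d,
            if P ^ j ∣ g then (P.natDegree : ℂ) * χ g else 0 := by
          refine Finset.sum_congr rfl fun g hg => ?_
          obtain ⟨hm, hd⟩ := mem_monicsOfDegree.1 hg
          rw [natDegree_eq_sum_monicIrreducibles hm hd]
          push_cast
          simp_rw [Finset.sum_mul]
          refine Finset.sum_congr rfl fun P _ => Finset.sum_congr rfl fun j _ => ?_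
          split_ifs <;> simp
      _ = ∑ P ∈ monicIrreducibles k d, ∑ j ∈ Finset.Icc 1 d, ∑ g ∈ monicsOfDegree k d,
            if P ^ j ∣ g then (P.natDegree : ℂ) * χ g else 0 := by
          rw [Finset.sum_comm]
          exact Finset.sum_congr rfl fun P _ => Finset.sum_comm
      _ = _ := by
          refine Finset.sum_congr rfl fun P hP => Finset.sum_congr rfl fun j _ => ?_
          have hPm := (mem_monicIrreducibles.1 hP).1
          have hdeg : (P ^ j).natDegree = j * P.natDegree := natDegree_pow P j
          rw [← Finset.sum_filter, ← Finset.mul_sum]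
          split_ifs with h
          · rw [sum_filter_dvd_monicsOfDegree hχ (hPm.pow j) (by rw [hdeg]; exact h), hdeg]
          · rw [Finset.filter_eq_empty_iff.2, Finset.sum_empty, mul_zero]
            intro g hg hdvd
            obtain ⟨hm, hd⟩ := mem_monicsOfDegree.1 hg
            have := natDegree_le_of_dvd hdvd hm.ne_zero
            rw [hdeg, hd] at this
            exact h this
  have hR : ∑ m ∈ Finset.Icc 1 d, primePowerSum χ m * A (d - m) =
      ∑ P ∈ monicIrreducibles k d, ∑ m ∈ Finset.Icc 1 d, if P.natDegree ∣ m then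
        (P.natDegree : ℂ) * (χ (P ^ (m / P.natDegree)) * A (d - m)) else 0 := by
    rw [Finset.sum_comm]
    refine Finset.sum_congr rfl fun m hm => ?_
    obtain ⟨hm1, hmd⟩ := Finset.mem_Icc.1 hm
    rw [← Finset.sum_filter, primePowerSum, Finset.sum_mul]
    refine Finset.sum_congr ?_ fun P _ => by ring
    ext P
    simp only [Finset.mem_filter, mem_monicIrreducibles]
    constructor
    · rintro ⟨⟨h1, h2, h3⟩, h4⟩
      exact ⟨⟨h1, h2.trans hmd, h3⟩, h4⟩
    · rintro ⟨⟨h1, h2, h3⟩, h4⟩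
      exact ⟨⟨h1, Nat.le_of_dvd hm1 h4, h3⟩, h4⟩
  rw [hL, hR]
  refine Finset.sum_congr rfl fun P hP => ?_
  have hpos := (mem_monicIrreducibles.1 hP).2.2.natDegree_pos
  rw [← Finset.sum_filter, ← Finset.sum_filter]
  refine Finset.sum_bij (fun j _ => j * P.natDegree) ?_ ?_ ?_ ?_
  · intro j hj
    simp only [Finset.mem_filter, Finset.mem_Icc] at hj ⊢
    exact ⟨⟨Nat.mul_pos hj.1.1 hpos, hj.2⟩, dvd_mul_left _ _⟩
  · intro a _ b _ hab
    exact Nat.eq_of_mul_eq_mul_right hpos hab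
  · intro m hm
    simp only [Finset.mem_filter, Finset.mem_Icc] at hm
    obtain ⟨⟨h1, h2⟩, j, rfl⟩ := hm
    refine ⟨j, ?_, mul_comm _ _⟩
    simp only [Finset.mem_filter, Finset.mem_Icc]
    have hj : 1 ≤ j := Nat.pos_of_mul_pos_left h1
    exact ⟨⟨hj, (Nat.le_mul_of_pos_left j hpos).trans h2⟩, by rwa [mul_comm]⟩
  · intro j _
    rw [Nat.mul_div_cancel _ hpos]

end EulerProduct

section FiniteFieldExtension

variable {k F : Type*} [Field k] [Finite k] [Field F] [Fintype F] [Algebra k F]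

/-- Summing over a finite field according to minimal polynomials. -/
theorem sum_minpoly_eq (h : k[X] → ℂ) :
    ∑ x : F, h (minpoly k x) = ∑ P ∈ monicIrreducibles k (Module.finrank k F) with
      P.natDegree ∣ Module.finrank k F, (P.natDegree : ℂ) * h P := by
  classical
  have : FiniteDimensional k F := Module.Finite.of_finite
  have hint : ∀ x : F, IsIntegral k x := fun x => Algebra.IsIntegral.isIntegral x
  rw [← Finset.sum_fiberwise_of_maps_to (s := Finset.univ) (g := fun x : F => minpoly k x)
    (t := (monicIrreducibles k (Module.finrank k F)).filter
      fun P => P.natDegree ∣ Module.finrank k F)]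
  · refine Finset.sum_congr rfl fun P hP => ?_
    obtain ⟨hP, hdvd⟩ := Finset.mem_filter.1 hP
    obtain ⟨hPm, -, hPi⟩ := mem_monicIrreducibles.1 hP
    rw [Finset.sum_congr rfl (g := fun _ => h P)
      (fun x hx => by rw [(Finset.mem_filter.1 hx).2]), Finset.sum_const, nsmul_eq_mul]
    congr 2
    have hroots : (Finset.univ.filter fun x : F => minpoly k x = P) = (P.rootSet F).toFinset := by
      ext x
      simp only [Finset.mem_filter, Finset.mem_univ, true_and, Set.mem_toFinset,
        mem_rootSet_of_ne hPi.ne_zero]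
      constructor
      · rintro rfl; exact minpoly.aeval k x
      · intro hx; exact (minpoly.eq_of_irreducible_of_monic hPi hx hPm).symm
    rw [hroots, Set.toFinset_card]
    refine card_rootSet_eq_natDegree (PerfectField.separable_of_irreducible hPi) ?_
    have h1 : P ∣ X ^ Nat.card k ^ Module.finrank k F - X :=
      hPi.natDegree_dvd_iff_dvd_X_pow_card_pow_sub_X.1 hdvd
    have hcard : Nat.card k ^ Module.finrank k F = Fintype.card F := by
      rw [← Nat.card_eq_fintype_card, Module.natCard_eq_pow_finrank (K := k) (V := F)]
    rw [hcard] at h1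
    have h2 := map_dvd (mapRingHom (algebraMap k F)) h1
    simp only [coe_mapRingHom, Polynomial.map_sub, Polynomial.map_pow, map_X] at h2
    refine Splits.of_dvd ?_ (FiniteField.X_pow_card_sub_X_ne_zero F Fintype.one_lt_card) h2
    rw [← Nat.card_eq_fintype_card]
    exact Polynomial.splits_X_pow_nat_card_sub_X
  · intro x _
    refine Finset.mem_filter.2 ⟨mem_monicIrreducibles.2
      ⟨minpoly.monic (hint x), minpoly.natDegree_le x, minpoly.irreducible (hint x)⟩, ?_⟩
    exact minpoly.degree_dvd (hint x)

/-- The product of `X - σ x` over the Galois group is a power of the minimal polynomial. -/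
theorem prod_X_sub_C_algEquiv_eq (x : F) :
    ∏ σ : F ≃ₐ[k] F, (X - C (σ x)) =
      ((minpoly k x) ^ (Module.finrank k F / (minpoly k x).natDegree)).map (algebraMap k F) := by
  classical
  have : FiniteDimensional k F := Module.Finite.of_finite
  have hint : IsIntegral k x := Algebra.IsIntegral.isIntegral x
  have hsep : (minpoly k x).Separable :=
    PerfectField.separable_of_irreducible (minpoly.irreducible hint)
  have hm0 := minpoly.ne_zero hint
  set R := (minpoly k x).aroots F with hR
  have hnodup : R.Nodup := nodup_roots hsep.map
  have hsplit : ((minpoly k x).map (algebraMap k F)).Splits := Normal.splits inferInstance x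
  have hmin : (minpoly k x).map (algebraMap k F) = ∏ y ∈ R.toFinset, (X - C y) := by
    rw [hsplit.eq_prod_roots_of_monic ((minpoly.monic hint).map _), Finset.prod_multiset_map_count]
    refine Finset.prod_congr rfl fun y hy => ?_
    rw [Multiset.count_eq_one_of_mem hnodup (Multiset.mem_toFinset.1 hy), pow_one]
  have himage : Finset.univ.image (fun σ : F ≃ₐ[k] F => σ x) = R.toFinset := by
    ext y
    simp only [Finset.mem_image, Finset.mem_univ, true_and, Multiset.mem_toFinset, hR]
    rw [← isConjRoot_iff_mem_minpoly_aroots hint, IsConjRoot.comm, isConjRoot_iff_exists_algEquiv]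
  set c := (Finset.univ.filter fun σ : F ≃ₐ[k] F => σ x = x).card with hc
  have hfib : ∀ y ∈ R.toFinset, (Finset.univ.filter fun σ : F ≃ₐ[k] F => σ x = y).card = c := by
    intro y hy
    rw [← himage] at hy
    obtain ⟨τ, -, rfl⟩ := Finset.mem_image.1 hy
    symm
    refine Finset.card_bij (fun σ _ => τ * σ) ?_ (fun a _ b _ h => mul_left_cancel h) ?_
    · intro σ hσ
      simp only [Finset.mem_filter, Finset.mem_univ, true_and] at hσ ⊢
      rw [AlgEquiv.mul_apply, hσ]
    · intro σ hσ
      simp only [Finset.mem_filter, Finset.mem_univ, true_and] at hσ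
      refine ⟨τ⁻¹ * σ, ?_, mul_inv_cancel_left τ σ⟩
      simp only [Finset.mem_filter, Finset.mem_univ, true_and]
      rw [AlgEquiv.mul_apply, hσ, ← AlgEquiv.mul_apply, inv_mul_cancel, AlgEquiv.one_apply]
  have hprod : ∏ σ : F ≃ₐ[k] F, (X - C (σ x)) = ((minpoly k x).map (algebraMap k F)) ^ c := by
    rw [Finset.prod_comp (fun y => (X - C y : F[X])) (fun σ : F ≃ₐ[k] F => σ x), himage, hmin,
      ← Finset.prod_pow]
    exact Finset.prod_congr rfl fun y hy => by rw [hfib y hy]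
  have hdeg := congrArg natDegree hprod
  rw [natDegree_pow, natDegree_map, natDegree_prod_of_monic _ _ (fun σ _ => monic_X_sub_C _)] at hdeg
  simp only [natDegree_X_sub_C, Finset.sum_const, smul_eq_mul, mul_one, Finset.card_univ] at hdeg
  rw [← Nat.card_eq_fintype_card, IsGalois.card_aut_eq_finrank] at hdeg
  rw [hprod, Polynomial.map_pow, hdeg, Nat.mul_div_cancel _ (minpoly.natDegree_pos hint)]

end FiniteFieldExtension

section RootSum

variable {K : Type*} [Field K]

/-- For a monic `g` with `g(0) ≠ 0`, the sum of `a x + b x⁻²` over the roots `x` of `g`. -/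
noncomputable def rootSum (a b : K) (g : K[X]) : K :=
  -a * g.nextCoeff + b * ((g.coeff 1) ^ 2 - 2 * g.coeff 0 * g.coeff 2) / (g.coeff 0) ^ 2

theorem rootSum_mul (a b : K) {g h : K[X]} (hg : g.Monic) (hh : h.Monic) (hg0 : g.coeff 0 ≠ 0)
    (hh0 : h.coeff 0 ≠ 0) : rootSum a b (g * h) = rootSum a b g + rootSum a b h := by
  have h1 : (g * h).coeff 1 = g.coeff 0 * h.coeff 1 + g.coeff 1 * h.coeff 0 := by
    rw [coeff_mul, Finset.Nat.sum_antidiagonal_eq_sum_range_succ_mk]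
    simp [Finset.sum_range_succ]
  have h2 : (g * h).coeff 2 =
      g.coeff 0 * h.coeff 2 + g.coeff 1 * h.coeff 1 + g.coeff 2 * h.coeff 0 := by
    rw [coeff_mul, Finset.Nat.sum_antidiagonal_eq_sum_range_succ_mk]
    simp [Finset.sum_range_succ]
  rw [rootSum, rootSum, rootSum, hg.nextCoeff_mul hh, mul_coeff_zero, h1, h2]
  field_simp
  ring

theorem rootSum_one (a b : K) : rootSum a b 1 = 0 := by
  simp [rootSum, coeff_one, nextCoeff]

theorem rootSum_X_sub_C (a b : K) {x : K} (hx : x ≠ 0) :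
    rootSum a b (X - C x) = a * x + b * (x⁻¹) ^ 2 := by
  have h2 : (X - C x).coeff 2 = 0 := by
    rw [coeff_sub, coeff_X, coeff_C]; simp
  rw [rootSum, nextCoeff_X_sub_C, h2]
  simp [coeff_X, coeff_C]
  field_simp

theorem rootSum_map {L : Type*} [Field L] (f : K →+* L) (a b : K) (g : K[X]) :
    rootSum (f a) (f b) (g.map f) = f (rootSum a b g) := by
  simp [rootSum, nextCoeff_map_eq, coeff_map, map_ofNat f 2]

theorem rootSum_prod_X_sub_C (a b : K) {ι : Type*} (s : Finset ι) (x : ι → K)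
    (hx : ∀ i ∈ s, x i ≠ 0) :
    rootSum a b (∏ i ∈ s, (X - C (x i))) = ∑ i ∈ s, (a * x i + b * ((x i)⁻¹) ^ 2) := by
  classical
  induction s using Finset.induction_on with
  | empty => simp [rootSum_one]
  | insert i s hi ih =>
    have hs : ∀ j ∈ s, x j ≠ 0 := fun j hj => hx j (Finset.mem_insert_of_mem hj)
    have hi0 := hx i (Finset.mem_insert_self i s)
    rw [Finset.prod_insert hi, Finset.sum_insert hi, rootSum_mul, ih hs, rootSum_X_sub_C a b hi0]
    · exact monic_X_sub_C _
    · exact monic_prod_of_monic _ _ fun j _ => monic_X_sub_C _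
    · simpa using hi0
    · rw [coeff_zero_prod]
      exact Finset.prod_ne_zero_iff.2 fun j hj => by simpa using hs j hj

end RootSum

section RootChar

variable {p : ℕ} [Fact p.Prime]

/-- The multiplicative function on monic polynomials attached to `ψ (a x + b x⁻²)`. -/
noncomputable def rootChar (ψ : AddChar (ZMod p) ℂ) (a b : ZMod p) (g : (ZMod p)[X]) : ℂ :=
  if g.coeff 0 = 0 then 0 else ψ (rootSum a b g)

variable (ψ : AddChar (ZMod p) ℂ) (a b : ZMod p)

theorem rootChar_mul (g h : (ZMod p)[X]) (hg : g.Monic) (hh : h.Monic) :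
    rootChar ψ a b (g * h) = rootChar ψ a b g * rootChar ψ a b h := by
  unfold rootChar
  rw [mul_coeff_zero]
  by_cases hg0 : g.coeff 0 = 0
  · simp [hg0]
  by_cases hh0 : h.coeff 0 = 0
  · simp [hh0]
  rw [if_neg (mul_ne_zero hg0 hh0), if_neg hg0, if_neg hh0, rootSum_mul a b hg hh hg0 hh0,
    AddChar.map_add_eq_mul]

/-- The coefficients of the logarithmic derivative of the `L`-function are exponential sums over
extensions of the base field. -/
theorem primePowerSum_rootChar {F : Type*} [Field F] [Fintype F] [DecidableEq F]
    [Algebra (ZMod p) F] :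
    primePowerSum (rootChar ψ a b) (Module.finrank (ZMod p) F) =
      ∑ x : F with x ≠ 0, ψ (Algebra.trace (ZMod p) F
        (algebraMap _ F a * x + algebraMap _ F b * (x⁻¹) ^ 2)) := by
  have : FiniteDimensional (ZMod p) F := Module.Finite.of_finite
  set m := Module.finrank (ZMod p) F with hm
  rw [primePowerSum, ← sum_minpoly_eq (F := F)
    (fun P => rootChar ψ a b (P ^ (m / P.natDegree))), Finset.sum_filter]
  refine Finset.sum_congr rfl fun x _ => ?_
  have hint : IsIntegral (ZMod p) x := Algebra.IsIntegral.isIntegral x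
  have hdvd : (minpoly (ZMod p) x).natDegree ∣ m := minpoly.degree_dvd hint
  have hpos : 0 < m := Module.finrank_pos
  have hne : m / (minpoly (ZMod p) x).natDegree ≠ 0 :=
    (Nat.div_pos (Nat.le_of_dvd hpos hdvd) (minpoly.natDegree_pos hint)).ne'
  have h0 : ((minpoly (ZMod p) x) ^ (m / (minpoly (ZMod p) x).natDegree)).coeff 0 = 0 ↔ x = 0 := by
    rw [coeff_zero_eq_eval_zero, eval_pow, pow_eq_zero_iff hne, ← coeff_zero_eq_eval_zero,
      minpoly.coeff_zero_eq_zero hint]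
  unfold rootChar
  by_cases hx : x = 0
  · rw [if_pos (h0.2 hx), if_neg (not_not.2 hx)]
  · rw [if_neg (mt h0.1 hx), if_pos hx]
    congr 1
    apply (algebraMap (ZMod p) F).injective
    rw [← rootSum_map, ← prod_X_sub_C_algEquiv_eq, trace_eq_sum_automorphisms,
      rootSum_prod_X_sub_C _ _ _ _ (fun σ _ => by simpa using hx)]
    refine Finset.sum_congr rfl fun σ _ => ?_
    simp

theorem sum_rootChar_monicsOfDegree_zero :
    ∑ g ∈ monicsOfDegree (ZMod p) 0, rootChar ψ a b g = 1 := by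
  have : monicsOfDegree (ZMod p) 0 = {1} := by
    ext g
    rw [mem_monicsOfDegree, Finset.mem_singleton]
    constructor
    · rintro ⟨h1, h2⟩; exact eq_one_of_monic_natDegree_zero h1 h2
    · rintro rfl; exact ⟨monic_one, natDegree_one⟩
  rw [this, Finset.sum_singleton, rootChar, rootSum_one]
  simp

theorem sum_rootChar_monicsOfDegree_one :
    ∑ g ∈ monicsOfDegree (ZMod p) 1, rootChar ψ a b g =
      ∑ x : ZMod p with x ≠ 0, ψ (a * x + b * (x⁻¹) ^ 2) := by
  have : monicsOfDegree (ZMod p) 1 = Finset.univ.image (fun x : ZMod p => X - C x) := by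
    ext g
    rw [mem_monicsOfDegree, Finset.mem_image]
    constructor
    · rintro ⟨h1, h2⟩
      refine ⟨-g.coeff 0, Finset.mem_univ _, ?_⟩
      rw [h1.eq_X_add_C h2]; simp
    · rintro ⟨x, -, rfl⟩; exact ⟨monic_X_sub_C x, natDegree_X_sub_C x⟩
  rw [this, Finset.sum_image (fun x _ y _ h => by simpa using h), Finset.sum_filter]
  refine Finset.sum_congr rfl fun x _ => ?_
  unfold rootChar
  by_cases hx : x = 0
  · simp [hx]
  · rw [if_neg (by simpa using hx), if_pos hx, rootSum_X_sub_C a b hx]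

variable {ψ a} in
/-- The `L`-function is a polynomial of degree at most three. -/
theorem sum_rootChar_monicsOfDegree_eq_zero (hψ : ψ ≠ 1) (ha : a ≠ 0) {d : ℕ} (hd : 4 ≤ d) :
    ∑ g ∈ monicsOfDegree (ZMod p) d, rootChar ψ a b g = 0 := by
  obtain ⟨c, hc⟩ := AddChar.ne_one_iff.1 hψ
  set e : ZMod p := -(a⁻¹ * c) with he
  have hshift : ∀ (e : ZMod p) (g : (ZMod p)[X]), g ∈ monicsOfDegree (ZMod p) d →
      g + C e * X ^ (d - 1) ∈ monicsOfDegree (ZMod p) d := by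
    intro e g hg
    obtain ⟨hm, hdeg⟩ := mem_monicsOfDegree.1 hg
    have hlt : (C e * X ^ (d - 1)).degree < g.degree := by
      rw [degree_eq_natDegree hm.ne_zero, hdeg]
      refine (degree_C_mul_X_pow_le _ _).trans_lt ?_
      exact_mod_cast Nat.sub_lt (by omega) one_pos
    exact mem_monicsOfDegree.2 ⟨hm.add_of_left hlt,
      by rw [natDegree_add_eq_left_of_degree_lt hlt, hdeg]⟩
  have hval : ∀ g ∈ monicsOfDegree (ZMod p) d,
      rootChar ψ a b (g + C e * X ^ (d - 1)) = ψ c * rootChar ψ a b g := by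
    intro g hg
    obtain ⟨hm, hdeg⟩ := mem_monicsOfDegree.1 hg
    obtain ⟨hm', hdeg'⟩ := mem_monicsOfDegree.1 (hshift e g hg)
    have hco : ∀ i < 3, (g + C e * X ^ (d - 1)).coeff i = g.coeff i := by
      intro i hi
      rw [coeff_add, coeff_C_mul_X_pow, if_neg (by omega), add_zero]
    have hnext : (g + C e * X ^ (d - 1)).nextCoeff = g.nextCoeff + e := by
      rw [nextCoeff_of_natDegree_pos (by omega), nextCoeff_of_natDegree_pos (by omega), hdeg, hdeg',
        coeff_add, coeff_C_mul_X_pow, if_pos rfl]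
    unfold rootChar
    rw [hco 0 (by norm_num)]
    split_ifs with h0
    · simp
    · rw [← AddChar.map_add_eq_mul]
      congr 1
      rw [rootSum, rootSum, hco 0 (by norm_num), hco 1 (by norm_num), hco 2 (by norm_num), hnext, he]
      field_simp
      ring
  have hsum : ∑ g ∈ monicsOfDegree (ZMod p) d, rootChar ψ a b g =
      ψ c * ∑ g ∈ monicsOfDegree (ZMod p) d, rootChar ψ a b g := by
    rw [Finset.mul_sum]
    symm
    refine Finset.sum_bij (fun g _ => g + C e * X ^ (d - 1)) (hshift e)
      (fun g _ h _ hgh => add_right_cancel hgh) (fun g hg => ?_) (fun g hg => (hval g hg).symm)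
    refine ⟨g + C (-e) * X ^ (d - 1), hshift (-e) g hg, ?_⟩
    simp
  have : (1 - ψ c) * ∑ g ∈ monicsOfDegree (ZMod p) d, rootChar ψ a b g = 0 := by
    rw [sub_mul, one_mul, ← hsum, sub_self]
  exact (mul_eq_zero.1 this).resolve_left (sub_ne_zero.2 (Ne.symm hc))

end RootChar

theorem exists_factor_monic_cubic (a b c : ℂ) :
    ∃ x y z : ℂ, a = -(x + y + z) ∧ b = x * y + y * z + z * x ∧ c = -(x * y * z) := by
  obtain ⟨x, hx⟩ := IsAlgClosed.exists_root (X ^ 3 + C a * X ^ 2 + C b * X + C c : ℂ[X]) (by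
    have : (X ^ 3 + C a * X ^ 2 + C b * X + C c : ℂ[X]).degree = 3 := by compute_degree!
    rw [this]; norm_num)
  obtain ⟨y, hy⟩ := IsAlgClosed.exists_root
    (X ^ 2 + C (a + x) * X + C (b + x * (a + x)) : ℂ[X]) (by
    have : (X ^ 2 + C (a + x) * X + C (b + x * (a + x)) : ℂ[X]).degree = 2 := by compute_degree!
    rw [this]; norm_num)
  simp only [IsRoot.def, eval_add, eval_mul, eval_pow, eval_X, eval_C] at hx hy
  refine ⟨x, y, -a - x - y, by ring, ?_, ?_⟩
  · linear_combination hy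
  · linear_combination hx - x * hy

/-- Newton's identities: a sequence whose associated `L`-function is a polynomial of degree at
most three is minus a sum of three geometric progressions. -/
theorem exists_powerSum_of_newton (A S : ℕ → ℂ) (h0 : A 0 = 1) (h4 : ∀ d, 4 ≤ d → A d = 0)
    (hN : ∀ d : ℕ, (d : ℂ) * A d = ∑ m ∈ Finset.Icc 1 d, S m * A (d - m)) :
    ∃ x y z : ℂ, ∀ n, 1 ≤ n → S n = -(x ^ n + y ^ n + z ^ n) := by
  obtain ⟨x, y, z, h1, h2, h3⟩ := exists_factor_monic_cubic (A 1) (A 2) (A 3)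
  refine ⟨x, y, z, ?_⟩
  have e1 : S 1 = A 1 := by have := hN 1; simp [h0] at this; exact this.symm
  have e2 : S 2 = 2 * A 2 - S 1 * A 1 := by
    have := hN 2
    rw [Finset.sum_Icc_succ_top (by norm_num)] at this
    simp [h0] at this
    linear_combination -this
  have e3 : S 3 = 3 * A 3 - S 1 * A 2 - S 2 * A 1 := by
    have := hN 3
    rw [Finset.sum_Icc_succ_top (by norm_num), Finset.sum_Icc_succ_top (by norm_num)] at this
    simp [h0] at this
    linear_combination -this
  have hrec : ∀ n, S (n + 4) = -(A 1 * S (n + 3) + A 2 * S (n + 2) + A 3 * S (n + 1)) := by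
    intro n
    have := hN (n + 4)
    rw [h4 _ (by omega), mul_zero, Finset.sum_Icc_succ_top (by omega),
      Finset.sum_Icc_succ_top (by omega), Finset.sum_Icc_succ_top (by omega),
      Finset.sum_Icc_succ_top (by omega), Finset.sum_eq_zero] at this
    · simp only [Nat.sub_self, show n + 4 - (n + 1) = 3 by omega,
        show n + 4 - (n + 1 + 1) = 2 by omega, show n + 4 - (n + 1 + 1 + 1) = 1 by omega, h0] at this
      linear_combination -this
    · intro m hm
      have := Finset.mem_Icc.1 hm
      rw [h4 _ (by omega), mul_zero]
  intro n
  induction n using Nat.strong_induction_on with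
  | _ n ih =>
    intro hn
    match n, hn with
    | 1, _ => rw [e1, h1]; ring
    | 2, _ => rw [e2, e1, h1, h2]; ring
    | 3, _ => rw [e3, e2, e1, h1, h2, h3]; ring
    | n + 4, _ =>
      rw [hrec, ih (n + 3) (by omega) (by omega), ih (n + 2) (by omega) (by omega),
        ih (n + 1) (by omega) (by omega), h1, h2, h3]
      ring

theorem norm_le_of_powerSum_three_le {x y z : ℂ} {M : ℝ} (hM : 1 ≤ M)
    (h1 : ‖x + y + z‖ ≤ M) (h2 : ‖x ^ 2 + y ^ 2 + z ^ 2‖ ≤ M) (h3 : ‖x ^ 3 + y ^ 3 + z ^ 3‖ ≤ M) :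
    ‖x‖ ≤ 3 * M ^ 3 := by
  by_contra! hx
  have hM2 : M ≤ M ^ 2 := by nlinarith
  have hM3 : M ^ 2 ≤ M ^ 3 := by nlinarith [sq_nonneg M]
  set s₁ := x + y + z with hs1
  set s₂ := x ^ 2 + y ^ 2 + z ^ 2 with hs2
  set s₃ := x ^ 3 + y ^ 3 + z ^ 3 with hs3
  have hroot : x ^ 3 = s₁ * x ^ 2 - (s₁ ^ 2 - s₂) / 2 * x + (s₁ ^ 3 - 3 * s₁ * s₂ + 2 * s₃) / 6 := by
    rw [hs1, hs2, hs3]; ring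
  have b1 : ‖s₁‖ ≤ M ^ 3 := by linarith
  have b2 : ‖(s₁ ^ 2 - s₂) / 2‖ ≤ M ^ 3 := by
    rw [norm_div]
    have : ‖s₁ ^ 2 - s₂‖ ≤ M ^ 2 + M := (norm_sub_le _ _).trans (by
      rw [norm_pow]; gcongr)
    norm_num
    linarith
  have b3 : ‖(s₁ ^ 3 - 3 * s₁ * s₂ + 2 * s₃) / 6‖ ≤ M ^ 3 := by
    rw [norm_div]
    have : ‖s₁ ^ 3 - 3 * s₁ * s₂ + 2 * s₃‖ ≤ M ^ 3 + 3 * M * M + 2 * M := by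
      refine (norm_add_le _ _).trans (add_le_add ((norm_sub_le _ _).trans (add_le_add ?_ ?_)) ?_)
      · rw [norm_pow]; gcongr
      · rw [norm_mul, norm_mul]; norm_num; gcongr
      · rw [norm_mul]; norm_num; gcongr
    norm_num
    nlinarith
  have hle : ‖x‖ ^ 3 ≤ M ^ 3 * ‖x‖ ^ 2 + M ^ 3 * ‖x‖ + M ^ 3 := by
    rw [← norm_pow, hroot]
    refine (norm_add_le _ _).trans (add_le_add ((norm_sub_le _ _).trans (add_le_add ?_ ?_)) b3)
    · rw [norm_mul, norm_pow]; gcongr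
    · rw [norm_mul]; gcongr
  have hx1 : 1 ≤ ‖x‖ := by nlinarith
  have hx2 : ‖x‖ ≤ ‖x‖ ^ 2 := by nlinarith
  have : 0 < M ^ 3 := by positivity
  nlinarith [mul_lt_mul_of_pos_right hx (show 0 < ‖x‖ ^ 2 by positivity)]

theorem norm_le_one_of_powerSums_bounded {x y z : ℂ} {M : ℝ} {n₀ : ℕ}
    (h : ∀ n, n₀ ≤ n → ‖x ^ n + y ^ n + z ^ n‖ ≤ M) : ‖x‖ ≤ 1 := by
  by_contra! hx
  obtain ⟨N, hN⟩ := pow_unbounded_of_one_lt (3 * (max M 1) ^ 3) hx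
  have key : ∀ n, n₀ ≤ n → ‖x‖ ^ n ≤ 3 * (max M 1) ^ 3 := by
    intro n hn
    rw [← norm_pow]
    refine norm_le_of_powerSum_three_le (y := y ^ n) (z := z ^ n) (le_max_right _ _)
      ((h n hn).trans (le_max_left _ _)) ?_ ?_
    · simp only [← pow_mul]
      exact (h _ (by omega)).trans (le_max_left _ _)
    · simp only [← pow_mul]
      exact (h _ (by omega)).trans (le_max_left _ _)
  have h1 := key (max N n₀) (le_max_right _ _)
  have h2 := pow_le_pow_right₀ hx.le (le_max_left N n₀)
  linarith

/-- The Weil bound for the exponential sums attached to `a x + b x⁻²` over a prime field. -/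
theorem norm_sum_addChar_le {p : ℕ} [Fact p.Prime] {ψ : AddChar (ZMod p) ℂ} (hψ : ψ ≠ 1)
    {a : ZMod p} (ha : a ≠ 0) (b : ZMod p) :
    ‖∑ x : ZMod p with x ≠ 0, ψ (a * x + b * (x⁻¹) ^ 2)‖ ≤ 3 * Real.sqrt p := by
  classical
  have hp : p.Prime := Fact.out
  have hp0 : (0 : ℝ) < p := by exact_mod_cast hp.pos
  obtain ⟨x, y, z, hS⟩ := exists_powerSum_of_newton
    (fun d => ∑ g ∈ monicsOfDegree (ZMod p) d, rootChar ψ a b g)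
    (primePowerSum (rootChar ψ a b)) (sum_rootChar_monicsOfDegree_zero ψ a b)
    (fun d hd => sum_rootChar_monicsOfDegree_eq_zero b hψ ha hd)
    (natCast_mul_sum_monicsOfDegree (rootChar_mul ψ a b))
  have hbound : ∀ n, 3 ≤ n → ‖x ^ (2 * n) + y ^ (2 * n) + z ^ (2 * n)‖ ≤ 6 * p * (p : ℝ) ^ n := by
    intro n hn
    obtain ⟨r, rfl⟩ : ∃ r, n = r + 1 := ⟨n - 1, by omega⟩
    have hne : 2 * (r + 1) ≠ 0 := by omega
    let := Fintype.ofFinite (GaloisField p (2 * (r + 1)))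
    have hcard : Fintype.card (GaloisField p (2 * (r + 1))) = p ^ (2 * (r + 1)) := by
      rw [← Nat.card_eq_fintype_card, GaloisField.card p _ hne]
    have h1 := norm_sum_trace_le (F := GaloisField p (2 * (r + 1))) (r := r) (by omega) hcard ha b hψ
    rw [← primePowerSum_rootChar ψ a b, GaloisField.finrank p hne, hS _ (by omega), norm_neg] at h1
    exact h1
  have hroot : ∀ x y z : ℂ, (∀ n, 3 ≤ n → ‖x ^ (2 * n) + y ^ (2 * n) + z ^ (2 * n)‖ ≤
      6 * p * (p : ℝ) ^ n) → ‖x‖ ≤ Real.sqrt p := by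
    intro x y z h
    have h1 : ‖x ^ 2 / p‖ ≤ 1 := by
      refine norm_le_one_of_powerSums_bounded (y := y ^ 2 / p) (z := z ^ 2 / p) (M := 6 * p)
        (n₀ := 3) fun n hn => ?_
      rw [div_pow, div_pow, div_pow, ← add_div, ← add_div, norm_div, norm_pow, Complex.norm_natCast,
        div_le_iff₀ (by positivity), ← pow_mul, ← pow_mul, ← pow_mul]
      exact h n hn
    rw [norm_div, Complex.norm_natCast, div_le_one hp0, norm_pow] at h1
    exact Real.le_sqrt_of_sq_le h1
  have h1 : ∑ x : ZMod p with x ≠ 0, ψ (a * x + b * (x⁻¹) ^ 2) = -(x + y + z) := by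
    have h2 := hS 1 le_rfl
    have h3 := natCast_mul_sum_monicsOfDegree (rootChar_mul ψ a b) 1
    simp only [Nat.cast_one, one_mul, Finset.Icc_self, Finset.sum_singleton, Nat.sub_self,
      sum_rootChar_monicsOfDegree_zero, mul_one, pow_one, sum_rootChar_monicsOfDegree_one] at h2 h3
    rw [h3, h2]
  rw [h1, norm_neg]
  have hx := hroot x y z hbound
  have hy := hroot y z x fun n hn => by
    have := hbound n hn
    rwa [add_assoc, add_comm] at this
  have hz := hroot z x y fun n hn => by
    have := hbound n hn
    rwa [add_comm, ← add_assoc] at this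
  have := norm_add₃_le (a := x) (b := y) (c := z)
  linarith

end PolynomialMethod

section StationaryPhase

variable {R : Type*} [CommRing R]

/-- The phase `γ u⁻² + μ u`. -/
def unitPhase (γ μ : R) (u : Rˣ) : R := γ * ((u⁻¹ : Rˣ) : R) ^ 2 + μ * u

/-- The logarithmic derivative `μ u - 2 γ u⁻²` of the phase. -/
def unitPhaseDeriv (γ μ : R) (u : Rˣ) : R := μ * u - 2 * γ * ((u⁻¹ : Rˣ) : R) ^ 2

/-- The unit `1 + a t`, for `a ^ 3 = 0`. -/
def oneAddUnit {a : R} (ha : a ^ 3 = 0) (t : R) : Rˣ where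
  val := 1 + a * t
  inv := 1 - a * t + a ^ 2 * t ^ 2
  val_inv := by linear_combination t ^ 3 * ha
  inv_val := by linear_combination t ^ 3 * ha

theorem unitPhase_mul_oneAddUnit (γ μ : R) {a : R} (ha : a ^ 3 = 0) (t : R) (u : Rˣ) :
    unitPhase γ μ (u * oneAddUnit ha t) = unitPhase γ μ u +
      (3 * γ * ((u⁻¹ : Rˣ) : R) ^ 2 * a ^ 2 * t ^ 2 + a * unitPhaseDeriv γ μ u * t) := by
  have h : (((oneAddUnit ha t)⁻¹ : Rˣ) : R) = 1 - a * t + a ^ 2 * t ^ 2 := rfl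
  have h' : ((oneAddUnit ha t : Rˣ) : R) = 1 + a * t := rfl
  simp only [unitPhase, unitPhaseDeriv, mul_inv, Units.val_mul, h, h']
  linear_combination (γ * ((u⁻¹ : Rˣ) : R) ^ 2 * (- 2 * t ^ 3 + a * t ^ 4)) * ha

theorem mul_unitPhaseDeriv_mul_oneAddUnit (γ μ : R) {a b : R} (ha : a ^ 3 = 0) (hb : b * a = 0)
    (t : R) (u : Rˣ) :
    b * unitPhaseDeriv γ μ (u * oneAddUnit ha t) = b * unitPhaseDeriv γ μ u := by
  have h : (((oneAddUnit ha t)⁻¹ : Rˣ) : R) = 1 - a * t + a ^ 2 * t ^ 2 := rfl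
  have h' : ((oneAddUnit ha t : Rˣ) : R) = 1 + a * t := rfl
  simp only [unitPhaseDeriv, mul_inv, Units.val_mul, h, h']
  linear_combination (μ * u * t - 2 * γ * ((u⁻¹ : Rˣ) : R) ^ 2 *
    (- 2 * t + 3 * a * t ^ 2 - 2 * a ^ 2 * t ^ 3 + a ^ 3 * t ^ 4)) * hb

variable [Fintype R]

theorem norm_sum_addChar_quadratic_sq_le [DecidableEq R] {ψ : AddChar R ℂ} (hψ : ψ.IsPrimitive)
    (α β : R) :
    ‖∑ t, ψ (α * t ^ 2 + β * t)‖ ^ 2 ≤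
      Fintype.card R * (Finset.univ.filter fun h : R => 2 * α * h = 0).card := by
  have h1 : ((‖∑ t, ψ (α * t ^ 2 + β * t)‖ ^ 2 : ℝ) : ℂ) =
      ∑ h, ψ (α * h ^ 2 + β * h) * ∑ s, ψ (s * (2 * α * h)) := by
    push_cast
    rw [← Complex.mul_conj', map_sum, Finset.sum_mul_sum, Finset.sum_comm]
    simp_rw [Finset.mul_sum]
    rw [Finset.sum_comm (s := Finset.univ) (t := Finset.univ)
      (f := fun h s => ψ (α * h ^ 2 + β * h) * ψ (s * (2 * α * h)))]
    refine Finset.sum_congr rfl fun s _ => ?_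
    rw [← Equiv.sum_comp (Equiv.addRight s)]
    refine Finset.sum_congr rfl fun h _ => ?_
    rw [← AddChar.map_neg_eq_conj, ← AddChar.map_add_eq_mul, ← AddChar.map_add_eq_mul]
    congr 1
    simp only [Equiv.coe_addRight]
    ring
  have h2 : ‖∑ t, ψ (α * t ^ 2 + β * t)‖ ^ 2 =
      ‖∑ h, ψ (α * h ^ 2 + β * h) * ∑ s, ψ (s * (2 * α * h))‖ := by
    rw [← h1, Complex.norm_real, Real.norm_of_nonneg (by positivity)]
  rw [h2]
  refine (norm_sum_le _ _).trans ?_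
  simp_rw [AddChar.sum_mulShift _ hψ, norm_mul, AddChar.norm_apply, one_mul]
  rw [Finset.card_filter, Nat.cast_sum, Finset.mul_sum]
  refine Finset.sum_le_sum fun h _ => ?_
  split_ifs <;> simp

theorem card_mul_sum_unitPhase (ψ : AddChar R ℂ) (γ μ : R) {a : R} (ha : a ^ 3 = 0)
    (A : Finset Rˣ) (hA : ∀ u t, u * oneAddUnit ha t ∈ A ↔ u ∈ A) :
    (Fintype.card R : ℂ) * ∑ u ∈ A, ψ (unitPhase γ μ u) =
      ∑ u ∈ A, ψ (unitPhase γ μ u) * ∑ t, ψ (3 * γ * ((u⁻¹ : Rˣ) : R) ^ 2 * a ^ 2 * t ^ 2 +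
        a * unitPhaseDeriv γ μ u * t) := by
  simp_rw [Finset.mul_sum, ← AddChar.map_add_eq_mul, ← unitPhase_mul_oneAddUnit γ μ ha]
  rw [Finset.sum_comm, ← Finset.mul_sum, ← nsmul_eq_mul, ← Finset.card_univ, ← Finset.sum_const]
  refine Finset.sum_congr rfl fun t _ => ?_
  symm
  refine Finset.sum_equiv (Equiv.mulRight (oneAddUnit ha t)) (fun u => ?_) fun u _ => rfl
  rw [Equiv.coe_mulRight, hA]

theorem sum_unitPhase_eq_sum_filter [DecidableEq R] {ψ : AddChar R ℂ} (hψ : ψ.IsPrimitive)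
    (γ μ : R) {a : R} (ha : a ^ 2 = 0) :
    ∑ u : Rˣ, ψ (unitPhase γ μ u) =
      ∑ u : Rˣ with a * unitPhaseDeriv γ μ u = 0, ψ (unitPhase γ μ u) := by
  have ha3 : a ^ 3 = 0 := by rw [pow_succ, ha, zero_mul]
  have h := card_mul_sum_unitPhase ψ γ μ ha3 Finset.univ (by simp)
  have hc : (Fintype.card R : ℂ) ≠ 0 := by simp
  have h2 : ∀ u : Rˣ, ∑ t, ψ (3 * γ * ((u⁻¹ : Rˣ) : R) ^ 2 * a ^ 2 * t ^ 2 +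
        a * unitPhaseDeriv γ μ u * t) =
      if a * unitPhaseDeriv γ μ u = 0 then (Fintype.card R : ℂ) else 0 := by
    intro u
    have := AddChar.sum_mulShift (a * unitPhaseDeriv γ μ u) hψ
    push_cast at this
    rw [← this]
    exact Finset.sum_congr rfl fun t _ => by rw [ha, mul_zero, zero_mul, zero_add, mul_comm]
  simp_rw [h2, mul_ite, mul_zero] at h
  rw [← Finset.sum_filter, ← Finset.sum_mul, mul_comm] at h
  exact mul_right_cancel₀ hc h

theorem norm_sum_unitPhase_le_card [DecidableEq R] {ψ : AddChar R ℂ} (hψ : ψ.IsPrimitive)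
    (γ μ : R) {a : R} (ha : a ^ 2 = 0) :
    ‖∑ u : Rˣ, ψ (unitPhase γ μ u)‖ ≤
      (Finset.univ.filter fun u : Rˣ => a * unitPhaseDeriv γ μ u = 0).card := by
  rw [sum_unitPhase_eq_sum_filter hψ γ μ ha]
  refine (norm_sum_le _ _).trans ?_
  simp

theorem card_mul_norm_sum_unitPhase_le [DecidableEq R] {ψ : AddChar R ℂ} (hψ : ψ.IsPrimitive)
    (γ μ : R) {a b : R} (ha : a ^ 3 = 0) (hb : b ^ 2 = 0) (hba : b * a = 0) {M : ℝ}
    (hM : ((Finset.univ.filter fun h : R => 6 * γ * a ^ 2 * h = 0).card : ℝ) ≤ M) :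
    Real.sqrt (Fintype.card R) * ‖∑ u : Rˣ, ψ (unitPhase γ μ u)‖ ≤
      (Finset.univ.filter fun u : Rˣ => b * unitPhaseDeriv γ μ u = 0).card * Real.sqrt M := by
  have hc : 0 < Real.sqrt (Fintype.card R) := Real.sqrt_pos.2 (by exact_mod_cast Fintype.card_pos)
  have h := card_mul_sum_unitPhase ψ γ μ ha
    (Finset.univ.filter fun u : Rˣ => b * unitPhaseDeriv γ μ u = 0)
    (by simp [mul_unitPhaseDeriv_mul_oneAddUnit γ μ ha hba])
  rw [← sum_unitPhase_eq_sum_filter hψ γ μ hb] at h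
  have h2 := congrArg norm h
  rw [norm_mul, Complex.norm_natCast] at h2
  have h3 : ∀ u : Rˣ, ‖∑ t, ψ (3 * γ * ((u⁻¹ : Rˣ) : R) ^ 2 * a ^ 2 * t ^ 2 +
        a * unitPhaseDeriv γ μ u * t)‖ ≤ Real.sqrt (Fintype.card R) * Real.sqrt M := by
    intro u
    rw [← Real.sqrt_mul (by positivity)]
    refine Real.le_sqrt_of_sq_le ((norm_sum_addChar_quadratic_sq_le hψ _ _).trans ?_)
    refine mul_le_mul_of_nonneg_left (le_trans ?_ hM) (by positivity)
    refine Nat.cast_le.2 (Finset.card_le_card fun x hx => ?_)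
    simp only [Finset.mem_filter, Finset.mem_univ, true_and] at hx ⊢
    have hu : (u : R) * ((u⁻¹ : Rˣ) : R) = 1 := Units.mul_inv u
    linear_combination (u : R) ^ 2 * hx -
      (u * ((u⁻¹ : Rˣ) : R) + 1) * (6 * γ * a ^ 2 * x) * hu
  have h4 : (Fintype.card R : ℝ) * ‖∑ u : Rˣ, ψ (unitPhase γ μ u)‖ ≤
      (Finset.univ.filter fun u : Rˣ => b * unitPhaseDeriv γ μ u = 0).card *
        (Real.sqrt (Fintype.card R) * Real.sqrt M) := by
    rw [h2]
    refine (norm_sum_le _ _).trans ?_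
    rw [← nsmul_eq_mul]
    refine Finset.sum_le_card_nsmul _ _ _ fun u _ => ?_
    rw [norm_mul, AddChar.norm_apply, one_mul]
    exact h3 u
  have h5 : Real.sqrt (Fintype.card R) * Real.sqrt (Fintype.card R) = Fintype.card R :=
    Real.mul_self_sqrt (by positivity)
  refine le_of_mul_le_mul_left ?_ hc
  rw [← mul_assoc, h5]
  linarith

end StationaryPhase

section PrimePower

theorem card_filter_natCast_mul_eq_zero_le {q : ℕ} [NeZero q] {n : ℕ} (hn : 0 < n) :
    (Finset.univ.filter fun h : ZMod q => (n : ZMod q) * h = 0).card ≤ n := by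
  simpa [nsmul_eq_mul] using IsAddCyclic.card_nsmul_eq_zero_le (α := ZMod q) hn

theorem natCast_pow_eq_zero {p k j : ℕ} (h : k ≤ j) : (p : ZMod (p ^ k)) ^ j = 0 :=
  pow_eq_zero_of_le h (by exact_mod_cast ZMod.natCast_self (p ^ k))

variable {p k : ℕ} [hp : Fact p.Prime]

theorem castHom_eq_zero_iff_exists (hk : p ∣ p ^ k) (x : ZMod (p ^ k)) :
    ZMod.castHom hk (ZMod p) x = 0 ↔ ∃ y, x = p * y := by
  constructor
  · intro h
    rw [← ZMod.natCast_zmod_val x, map_natCast, ZMod.natCast_eq_zero_iff] at h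
    obtain ⟨c, hc⟩ := h
    exact ⟨c, by rw [← ZMod.natCast_zmod_val x, hc]; push_cast; rfl⟩
  · rintro ⟨y, rfl⟩
    rw [map_mul, map_natCast, ZMod.natCast_self, zero_mul]

theorem isUnit_of_castHom_ne_zero (hk : p ∣ p ^ k) {x : ZMod (p ^ k)}
    (hx : ZMod.castHom hk (ZMod p) x ≠ 0) : IsUnit x := by
  rw [← ZMod.natCast_zmod_val x, map_natCast, Ne, ZMod.natCast_eq_zero_iff,
    ← hp.out.coprime_iff_not_dvd] at hx
  rw [← ZMod.natCast_zmod_val x, ZMod.isUnit_iff_coprime]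
  exact hx.symm.pow_right k

theorem castHom_eq_zero_of_pow_mul_eq_zero (hk : p ∣ p ^ k) {r : ℕ} (hr : r < k) {x : ZMod (p ^ k)}
    (h : (p : ZMod (p ^ k)) ^ r * x = 0) : ZMod.castHom hk (ZMod p) x = 0 := by
  rw [← ZMod.natCast_zmod_val x] at h ⊢
  rw [map_natCast, ZMod.natCast_eq_zero_iff]
  have h2 : ((p ^ r * x.val : ℕ) : ZMod (p ^ k)) = 0 := by push_cast; exact h
  rw [ZMod.natCast_eq_zero_iff] at h2
  have h3 : p ^ r * p ∣ p ^ r * x.val := by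
    rw [← pow_succ]
    exact (pow_dvd_pow p hr).trans h2
  exact Nat.dvd_of_mul_dvd_mul_left (pow_pos hp.out.pos r) h3

theorem six_mul_sub_one_eq_zero (hk : p ∣ p ^ k) {P w : ZMod (p ^ k)}
    (hw : ZMod.castHom hk (ZMod p) w = 1) (h : 2 * P * (w ^ 3 - 1) = 0) :
    6 * P * (w - 1) = 0 := by
  obtain ⟨x, hx⟩ := (castHom_eq_zero_iff_exists hk (w - 1)).1 (by rw [map_sub, hw, map_one, sub_self])
  obtain rfl | h3 := eq_or_ne p 3
  · have hu : IsUnit (1 + (3 : ZMod (3 ^ k)) * (x + x ^ 2)) := by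
      refine IsNilpotent.isUnit_one_add ⟨k, ?_⟩
      have := natCast_pow_eq_zero (p := 3) (k := k) le_rfl
      push_cast at this
      rw [mul_pow, this, zero_mul]
    refine hu.mul_left_eq_zero.1 ?_
    push_cast at hx
    have hw' : w = 1 + 3 * x := by linear_combination hx
    subst hw'
    linear_combination h
  · have hu : IsUnit (w ^ 2 + w + 1) := by
      refine isUnit_of_castHom_ne_zero hk ?_
      rw [map_add, map_add, map_pow, hw, map_one]
      intro h
      have h4 : ((3 : ℕ) : ZMod p) = 0 := by push_cast; linear_combination h
      rw [ZMod.natCast_eq_zero_iff] at h4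
      exact h3 ((Nat.prime_dvd_prime_iff_eq hp.out Nat.prime_three).1 h4)
    refine hu.mul_left_eq_zero.1 ?_
    linear_combination 3 * h

theorem castHom_pow_three_eq_one (hk : p ∣ p ^ k) {r : ℕ} (hr : r < k) (w : (ZMod (p ^ k))ˣ)
    (h : 2 * (p : ZMod (p ^ k)) ^ r * ((w : ZMod (p ^ k)) ^ 3 - 1) = 0) :
    ZMod.unitsMap hk w ^ 3 = 1 := by
  obtain rfl | h2 := eq_or_ne p 2
  · generalize ZMod.unitsMap hk w = v
    revert v
    decide
  · have hu : IsUnit (2 : ZMod (p ^ k)) := by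
      have : IsUnit ((2 : ℕ) : ZMod (p ^ k)) := by
        rw [ZMod.isUnit_iff_coprime]
        refine Nat.Coprime.pow_right k ?_
        exact (Nat.coprime_primes Nat.prime_two hp.out).2 h2.symm
      exact_mod_cast this
    have h3 := castHom_eq_zero_of_pow_mul_eq_zero hk hr (hu.mul_right_eq_zero.1 (by
      rw [← mul_assoc]; exact h))
    ext
    rw [map_sub, map_pow, map_one, sub_eq_zero] at h3
    rw [Units.val_pow_eq_pow_val]
    exact h3

theorem card_critical_le (hk : p ∣ p ^ k) {r : ℕ} (hr : r < k) {γ : ZMod (p ^ k)}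
    (μ : ZMod (p ^ k)) (hγ : IsUnit γ) :
    (Finset.univ.filter fun u : (ZMod (p ^ k))ˣ =>
      (p : ZMod (p ^ k)) ^ r * unitPhaseDeriv γ μ u = 0).card ≤ 18 * p ^ r := by
  set A := Finset.univ.filter fun u : (ZMod (p ^ k))ˣ =>
      (p : ZMod (p ^ k)) ^ r * unitPhaseDeriv γ μ u = 0 with hA
  have key : ∀ u ∈ A, ∀ v ∈ A,
      2 * (p : ZMod (p ^ k)) ^ r * (((u * v⁻¹ : (ZMod (p ^ k))ˣ) : ZMod (p ^ k)) ^ 3 - 1) = 0 := by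
    intro u hu v hv
    replace hu := (Finset.mem_filter.1 hu).2
    replace hv := (Finset.mem_filter.1 hv).2
    rw [unitPhaseDeriv] at hu hv
    have h1 : (u : ZMod (p ^ k)) * ((u⁻¹ : (ZMod (p ^ k))ˣ) : ZMod (p ^ k)) = 1 := Units.mul_inv u
    have h2 : (v : ZMod (p ^ k)) * ((v⁻¹ : (ZMod (p ^ k))ˣ) : ZMod (p ^ k)) = 1 := Units.mul_inv v
    refine hγ.mul_right_eq_zero.1 ?_
    rw [Units.val_mul]
    generalize ((u⁻¹ : (ZMod (p ^ k))ˣ) : ZMod (p ^ k)) = u' at *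
    generalize ((v⁻¹ : (ZMod (p ^ k))ˣ) : ZMod (p ^ k)) = v' at *
    generalize (u : ZMod (p ^ k)) = u at *
    generalize (v : ZMod (p ^ k)) = v at *
    generalize (p : ZMod (p ^ k)) ^ r = P at *
    have e1 : P * (μ * u ^ 3) = P * (2 * γ) := by
      linear_combination u ^ 2 * hu + 2 * P * γ * (u * u' + 1) * h1
    have e2 : P * (μ * v ^ 3) = P * (2 * γ) := by
      linear_combination v ^ 2 * hv + 2 * P * γ * (v * v' + 1) * h2
    have e3 : v ^ 3 * v' ^ 3 = 1 := by rw [← mul_pow, h2, one_pow]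
    linear_combination e1 - (u ^ 3 * v' ^ 3) * e2 + (P * μ * u ^ 3) * e3
  obtain hA0 | ⟨u₀, hu₀⟩ := A.eq_empty_or_nonempty
  · simp [hA0]
  have hmaps : ∀ u ∈ A, ZMod.unitsMap hk (u * u₀⁻¹) ∈
      Finset.univ.filter fun w : (ZMod p)ˣ => w ^ 3 = 1 := by
    intro u hu
    simpa using castHom_pow_three_eq_one hk hr _ (key u hu u₀ hu₀)
  have hcube : (Finset.univ.filter fun w : (ZMod p)ˣ => w ^ 3 = 1).card ≤ 3 :=
    IsCyclic.card_pow_eq_one_le (by norm_num)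
  have hfib : ∀ w ∈ Finset.univ.filter fun w : (ZMod p)ˣ => w ^ 3 = 1,
      (A.filter fun u => ZMod.unitsMap hk (u * u₀⁻¹) = w).card ≤ 6 * p ^ r := by
    intro w _
    obtain h0 | ⟨v, hv⟩ := (A.filter fun u => ZMod.unitsMap hk (u * u₀⁻¹) = w).eq_empty_or_nonempty
    · rw [h0]
      exact Nat.zero_le _
    rw [Finset.mem_filter] at hv
    refine le_trans (Finset.card_le_card_of_injOn
      (fun u => ((u * v⁻¹ : (ZMod (p ^ k))ˣ) : ZMod (p ^ k)) - 1) ?_ ?_)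
      (card_filter_natCast_mul_eq_zero_le (q := p ^ k) (n := 6 * p ^ r)
        (by have := pow_pos hp.out.pos r; omega))
    · intro u hu
      rw [Finset.mem_coe, Finset.mem_filter] at hu
      simp only [Finset.coe_filter, Finset.mem_univ, true_and, Set.mem_ofPred_eq]
      push_cast
      refine six_mul_sub_one_eq_zero hk ?_ (key u hu.1 v hv.1)
      have h1 : ZMod.unitsMap hk (u * v⁻¹) = 1 := by
        have : u * v⁻¹ = (u * u₀⁻¹) * (v * u₀⁻¹)⁻¹ := by
          rw [mul_inv, inv_inv, mul_mul_mul_comm, inv_mul_cancel, mul_one]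
        rw [this, map_mul, map_inv, hu.2, hv.2, mul_inv_cancel]
      exact congrArg Units.val h1
    · intro u _ u' _ h
      exact mul_right_cancel (Units.ext (sub_left_injective h))
  have := Finset.card_le_mul_card_image_of_maps_to hmaps _ hfib
  calc A.card ≤ _ := this
    _ ≤ 6 * p ^ r * 3 := Nat.mul_le_mul_left _ hcube
    _ = 18 * p ^ r := by ring

theorem card_critical_eq_zero (hk : p ∣ p ^ k) {r : ℕ} (hr : r < k) {γ μ : ZMod (p ^ k)}
    (hγ : ZMod.castHom hk (ZMod p) γ = 0) (hμ : ZMod.castHom hk (ZMod p) μ ≠ 0) :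
    (Finset.univ.filter fun u : (ZMod (p ^ k))ˣ =>
      (p : ZMod (p ^ k)) ^ r * unitPhaseDeriv γ μ u = 0).card = 0 := by
  rw [Finset.card_eq_zero, Finset.filter_eq_empty_iff]
  intro u _ h
  have h2 := castHom_eq_zero_of_pow_mul_eq_zero hk hr h
  rw [unitPhaseDeriv, map_sub, map_mul, map_mul, map_mul, hγ, mul_zero, zero_mul, sub_zero] at h2
  exact mul_ne_zero hμ (u.isUnit.map (ZMod.castHom hk (ZMod p))).ne_zero h2

theorem norm_sum_unitPhase_prime_pow_le (hk : p ∣ p ^ k) (hk2 : 2 ≤ k)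
    {ψ : AddChar (ZMod (p ^ k)) ℂ} (hψ : ψ.IsPrimitive) {γ μ : ZMod (p ^ k)}
    (h : ZMod.castHom hk (ZMod p) γ ≠ 0 ∨ ZMod.castHom hk (ZMod p) μ ≠ 0) :
    ‖∑ u : (ZMod (p ^ k))ˣ, ψ (unitPhase γ μ u)‖ ≤ 54 * Real.sqrt ((p ^ k : ℕ) : ℝ) := by
  have hp0 : (0 : ℝ) < p := by exact_mod_cast hp.out.pos
  have hcard : ∀ r < k, ((Finset.univ.filter fun u : (ZMod (p ^ k))ˣ =>
      (p : ZMod (p ^ k)) ^ r * unitPhaseDeriv γ μ u = 0).card : ℝ) ≤ 18 * p ^ r := by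
    intro r hr
    by_cases hγ : ZMod.castHom hk (ZMod p) γ = 0
    · rw [card_critical_eq_zero hk hr hγ (h.resolve_left (not_not.2 hγ))]
      rw [Nat.cast_zero]
      positivity
    · exact_mod_cast card_critical_le hk hr μ (isUnit_of_castHom_ne_zero hk hγ)
  by_cases hγ : ZMod.castHom hk (ZMod p) γ = 0
  · have h1 := norm_sum_unitPhase_le_card hψ γ μ (a := (p : ZMod (p ^ k)) ^ (k - 1)) (by
      rw [← pow_mul]
      exact natCast_pow_eq_zero (by omega))
    rw [card_critical_eq_zero hk (by omega) hγ (h.resolve_left (not_not.2 hγ))] at h1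
    refine h1.trans ?_
    rw [Nat.cast_zero]
    positivity
  obtain ⟨m, rfl | rfl⟩ := Nat.even_or_odd' k
  · have h1 := norm_sum_unitPhase_le_card hψ γ μ (a := (p : ZMod (p ^ (2 * m))) ^ m) (by
      rw [← pow_mul]
      exact natCast_pow_eq_zero (by omega))
    have h2 : Real.sqrt ((p ^ (2 * m) : ℕ) : ℝ) = p ^ m := by
      push_cast
      rw [mul_comm, pow_mul, Real.sqrt_sq (by positivity)]
    rw [h2]
    have := hcard m (by omega)
    have : (0 : ℝ) < p ^ m := by positivity
    linarith
  · have hγu := isUnit_of_castHom_ne_zero hk hγ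
    have h1 := card_mul_norm_sum_unitPhase_le hψ γ μ (a := (p : ZMod (p ^ (2 * m + 1))) ^ m)
      (b := (p : ZMod (p ^ (2 * m + 1))) ^ (m + 1)) (M := 6 * p ^ (2 * m))
      (by rw [← pow_mul]; exact natCast_pow_eq_zero (by omega))
      (by rw [← pow_mul]; exact natCast_pow_eq_zero (by omega))
      (by rw [← pow_add]; exact natCast_pow_eq_zero (by omega))
      (by
        have h2 := card_filter_natCast_mul_eq_zero_le (q := p ^ (2 * m + 1)) (n := 6 * p ^ (2 * m))
          (by have := pow_pos hp.out.pos (2 * m); omega)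
        have h3 : ∀ x : ZMod (p ^ (2 * m + 1)), 6 * γ * ((p : ZMod (p ^ (2 * m + 1))) ^ m) ^ 2 * x = 0 ↔
            ((6 * p ^ (2 * m) : ℕ) : ZMod (p ^ (2 * m + 1))) * x = 0 := by
          intro x
          rw [← hγu.mul_right_eq_zero (b := ((6 * p ^ (2 * m) : ℕ) : ZMod (p ^ (2 * m + 1))) * x)]
          push_cast
          constructor <;> intro h <;> linear_combination h
        simp_rw [h3]
        exact_mod_cast h2)
    have h2 := hcard (m + 1) (by omega)
    rw [ZMod.card] at h1
    have hpm : (0 : ℝ) < (p : ℝ) ^ m := by positivity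
    have h3 : Real.sqrt (6 * p ^ (2 * m)) ≤ 3 * p ^ m := by
      refine Real.sqrt_le_iff.2 ⟨by positivity, ?_⟩
      rw [mul_pow, ← pow_mul, mul_comm m 2]
      have : (0 : ℝ) < (p : ℝ) ^ (2 * m) := by positivity
      linarith
    have hs : 0 < Real.sqrt ((p ^ (2 * m + 1) : ℕ) : ℝ) :=
      Real.sqrt_pos.2 (by exact_mod_cast pow_pos hp.out.pos _)
    have h4 : Real.sqrt ((p ^ (2 * m + 1) : ℕ) : ℝ) * Real.sqrt ((p ^ (2 * m + 1) : ℕ) : ℝ) =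
        p ^ (m + 1) * p ^ m := by
      rw [Real.mul_self_sqrt (by positivity)]
      push_cast
      ring
    refine le_of_mul_le_mul_left ?_ hs
    calc _ ≤ _ := h1
      _ ≤ (18 * p ^ (m + 1)) * (3 * p ^ m) := by gcongr
      _ = 54 * (p ^ (m + 1) * p ^ m) := by ring
      _ = _ := by rw [← h4]; ring

end PrimePower

section Modulus

/-- The sum of `e_q(γ u⁻² + μ u)` over the units `u` modulo `q`. -/
noncomputable def inverseSquareSum (q : ℕ) [NeZero q] (γ μ : ℤ) : ℂ :=
  ∑ u : (ZMod q)ˣ, ZMod.stdAddChar (unitPhase (γ : ZMod q) (μ : ZMod q) u)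

theorem norm_inverseSquareSum_prime_le {p : ℕ} [hp : Fact p.Prime] {γ μ : ℤ}
    (h : (γ : ZMod p) ≠ 0 ∨ (μ : ZMod p) ≠ 0) :
    ‖inverseSquareSum p γ μ‖ ≤ 3 * Real.sqrt p := by
  have hprim := ZMod.isPrimitive_stdAddChar p
  have hne : (ZMod.stdAddChar : AddChar (ZMod p) ℂ) ≠ 1 := by
    simpa using hprim (one_ne_zero (α := ZMod p))
  have hunits : ∀ f : ZMod p → ℂ, ∑ u : (ZMod p)ˣ, f u = ∑ x : ZMod p with x ≠ 0, f x := by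
    intro f
    rw [Finset.sum_subtype (p := fun x : ZMod p => x ≠ 0) _ (by simp)]
    exact Equiv.sum_comp (unitsEquivNeZero (G₀ := ZMod p)) fun x => f x
  by_cases hμ : (μ : ZMod p) = 0
  · have hγ := h.resolve_right (not_not.2 hμ)
    have h1 : inverseSquareSum p γ μ =
        ∑ t : ZMod p, ZMod.stdAddChar ((γ : ZMod p) * t ^ 2 + 0 * t) - 1 := by
      rw [inverseSquareSum, ← Equiv.sum_comp (Equiv.inv (ZMod p)ˣ), ← Finset.add_sum_erase
        Finset.univ _ (Finset.mem_univ (0 : ZMod p))]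
      have := hunits fun t => ZMod.stdAddChar ((γ : ZMod p) * t ^ 2 + 0 * t)
      simp only [unitPhase, Equiv.inv_apply, inv_inv, hμ, zero_mul, add_zero] at this ⊢
      rw [this, ← Finset.filter_ne' Finset.univ (0 : ZMod p)]
      simp
    have h2 := norm_sum_addChar_quadratic_sq_le hprim (γ : ZMod p) 0
    have h3 : ((Finset.univ.filter fun h : ZMod p => 2 * (γ : ZMod p) * h = 0).card : ℝ) ≤ 2 := by
      have h4 := card_filter_natCast_mul_eq_zero_le (q := p) (n := 2) (by norm_num)
      have h5 : ∀ x : ZMod p, 2 * (γ : ZMod p) * x = 0 ↔ ((2 : ℕ) : ZMod p) * x = 0 := by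
        intro x
        push_cast
        simp [hγ]
      simp_rw [h5]
      exact_mod_cast h4
    have hp1 : (1 : ℝ) ≤ p := by exact_mod_cast hp.out.one_le
    have h6 : ‖∑ t : ZMod p, ZMod.stdAddChar ((γ : ZMod p) * t ^ 2 + 0 * t)‖ ≤
        2 * Real.sqrt p := by
      refine abs_le_of_sq_le_sq' ?_ (by positivity) |>.2
      rw [mul_pow, Real.sq_sqrt (by positivity)]
      rw [ZMod.card] at h2
      nlinarith
    have h7 : 1 ≤ Real.sqrt p := Real.one_le_sqrt.2 hp1
    rw [h1]
    refine (norm_sub_le _ _).trans ?_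
    rw [norm_one]
    linarith
  · have h1 := norm_sum_addChar_le hne hμ (γ : ZMod p)
    rw [← hunits fun x => ZMod.stdAddChar ((μ : ZMod p) * x + (γ : ZMod p) * x⁻¹ ^ 2)] at h1
    rw [inverseSquareSum]
    simpa only [unitPhase, Units.val_inv_eq_inv_val, add_comm] using h1

theorem norm_inverseSquareSum_le_totient (q : ℕ) [NeZero q] (γ μ : ℤ) :
    ‖inverseSquareSum q γ μ‖ ≤ q.totient := by
  refine (norm_sum_le _ _).trans ?_
  simp [ZMod.card_units_eq_totient]

theorem norm_inverseSquareSum_mul_le {p n N : ℕ} (hp : p.Prime) [NeZero n] [NeZero N]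
    (hN : N = p * n) (γ μ : ℤ) :
    ‖inverseSquareSum N (p * γ) (p * μ)‖ ≤ p * ‖inverseSquareSum n γ μ‖ := by
  have hdvd : n ∣ N := ⟨p, by rw [hN, mul_comm]⟩
  set π := ZMod.unitsMap hdvd with hπ
  have hsurj : Function.Surjective π := ZMod.unitsMap_surjective hdvd
  have hchar : ∀ x : ZMod N, (ZMod.stdAddChar ((p : ZMod N) * x) : ℂ) =
      ZMod.stdAddChar (ZMod.castHom hdvd (ZMod n) x) := by
    intro x
    obtain ⟨z, rfl⟩ := ZMod.intCast_surjective x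
    have h1 : (p : ZMod N) * (z : ZMod N) = ((p * z : ℤ) : ZMod N) := by push_cast; rfl
    rw [h1, map_intCast (ZMod.castHom hdvd (ZMod n)), ZMod.stdAddChar_coe, ZMod.stdAddChar_coe, hN]
    have h2 : (p : ℂ) ≠ 0 := by exact_mod_cast hp.ne_zero
    have h3 : (n : ℂ) ≠ 0 := by exact_mod_cast NeZero.ne n
    congr 1
    push_cast
    field_simp
  have hval : ∀ u : (ZMod N)ˣ, ((π u : (ZMod n)ˣ) : ZMod n) =
      ZMod.castHom hdvd (ZMod n) (u : ZMod N) := fun u => rfl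
  have hterm : ∀ u : (ZMod N)ˣ, (ZMod.stdAddChar (unitPhase (((p * γ : ℤ)) : ZMod N)
      ((p * μ : ℤ) : ZMod N) u) : ℂ) =
      ZMod.stdAddChar (unitPhase (γ : ZMod n) (μ : ZMod n) (π u)) := by
    intro u
    have h1 : unitPhase (((p * γ : ℤ)) : ZMod N) ((p * μ : ℤ) : ZMod N) u =
        p * unitPhase (γ : ZMod N) (μ : ZMod N) u := by
      simp only [unitPhase]
      push_cast
      ring
    rw [h1, hchar]
    congr 1
    simp only [unitPhase, map_add, map_mul, map_pow, map_intCast, ← hval, map_inv]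
  have hfib : ∀ v : (ZMod n)ˣ, (Finset.univ.filter fun u => π u = v).card =
      (Finset.univ.filter fun u => π u = 1).card := fun v =>
    MonoidHom.card_fiber_eq_of_mem_range π (hsurj v) (hsurj 1)
  set c := (Finset.univ.filter fun u => π u = 1).card with hc
  have hsum : ∀ f : (ZMod n)ˣ → ℂ, ∑ u, f (π u) = c * ∑ v, f v := by
    intro f
    rw [← Finset.sum_fiberwise Finset.univ π fun u => f (π u), Finset.mul_sum]
    refine Finset.sum_congr rfl fun v _ => ?_
    rw [← hfib v, ← nsmul_eq_mul, ← Finset.sum_const]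
    refine Finset.sum_congr rfl fun u hu => ?_
    rw [(Finset.mem_filter.1 hu).2]
  have hcp : c ≤ p := by
    have h1 : N.totient = c * n.totient := by
      rw [← ZMod.card_units_eq_totient N, ← ZMod.card_units_eq_totient n, ← Finset.card_univ,
        Finset.card_eq_sum_card_fiberwise (f := π) (t := Finset.univ) (by simp)]
      simp_rw [hfib]
      rw [Finset.sum_const, smul_eq_mul, mul_comm, Finset.card_univ]
    have h2 : N.totient ≤ p * n.totient := by
      rw [hN]
      by_cases h : p ∣ n
      · rw [Nat.totient_mul_of_prime_of_dvd hp h]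
      · rw [Nat.totient_mul_of_prime_of_not_dvd hp h]
        exact Nat.mul_le_mul_right _ (Nat.sub_le _ _)
    rw [h1] at h2
    exact Nat.le_of_mul_le_mul_right h2 (Nat.totient_pos.2 (NeZero.pos n))
  rw [inverseSquareSum]
  simp_rw [hterm]
  rw [hsum fun v => ZMod.stdAddChar (unitPhase (γ : ZMod n) (μ : ZMod n) v), norm_mul,
    Complex.norm_natCast]
  exact mul_le_mul_of_nonneg_right (by exact_mod_cast hcp) (norm_nonneg _)

theorem gcd_gcd_pos {q : ℕ} (hq : q ≠ 0) (γ μ : ℤ) : 0 < Int.gcd γ (Int.gcd μ (q : ℤ)) := by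
  refine Int.gcd_pos_of_ne_zero_right _ ?_
  have := Int.gcd_pos_of_ne_zero_right μ (b := (q : ℤ)) (by exact_mod_cast hq)
  exact_mod_cast this.ne'

theorem norm_inverseSquareSum_prime_pow_le {p : ℕ} (hp : p.Prime) (k : ℕ) :
    ∀ [NeZero (p ^ k)] (γ μ : ℤ), ‖inverseSquareSum (p ^ k) γ μ‖ ≤
      54 * Real.sqrt (Int.gcd γ (Int.gcd μ ((p ^ k : ℕ) : ℤ)) * (p ^ k : ℕ)) := by
  have := Fact.mk hp
  have hp0 : (0 : ℝ) < p := by exact_mod_cast hp.pos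
  induction k with
  | zero =>
    intro _ γ μ
    refine (norm_inverseSquareSum_le_totient _ γ μ).trans ?_
    simp
  | succ k ih =>
    intro _ γ μ
    have : NeZero (p ^ k) := ⟨pow_ne_zero k hp.ne_zero⟩
    by_cases h : (p : ℤ) ∣ γ ∧ (p : ℤ) ∣ μ
    · obtain ⟨⟨γ, rfl⟩, ⟨μ, rfl⟩⟩ := h
      have hg : Int.gcd (p * γ) (Int.gcd (p * μ) ((p ^ (k + 1) : ℕ) : ℤ)) =
          p * Int.gcd γ (Int.gcd μ ((p ^ k : ℕ) : ℤ)) := by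
        have h1 : ((p ^ (k + 1) : ℕ) : ℤ) = p * ((p ^ k : ℕ) : ℤ) := by push_cast; ring
        rw [h1, Int.gcd_mul_left, Int.natAbs_natCast, Nat.cast_mul, Int.gcd_mul_left,
          Int.natAbs_natCast]
      rw [hg]
      refine (norm_inverseSquareSum_mul_le hp (pow_succ' p k) γ μ).trans ?_
      have h2 : ((p * Int.gcd γ (Int.gcd μ ((p ^ k : ℕ) : ℤ)) : ℕ) : ℝ) * ((p ^ (k + 1) : ℕ) : ℝ) =
          (p : ℝ) ^ 2 * (Int.gcd γ (Int.gcd μ ((p ^ k : ℕ) : ℤ)) * (p ^ k : ℕ)) := by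
        push_cast
        ring
      rw [h2, Real.sqrt_mul (by positivity), Real.sqrt_sq hp0.le]
      have := mul_le_mul_of_nonneg_left (ih γ μ) hp0.le
      linarith
    · have hor : (γ : ZMod p) ≠ 0 ∨ (μ : ZMod p) ≠ 0 := by
        rw [← not_and_or, ZMod.intCast_zmod_eq_zero_iff_dvd, ZMod.intCast_zmod_eq_zero_iff_dvd]
        exact h
      have hg : Real.sqrt ((p ^ (k + 1) : ℕ) : ℝ) ≤
          Real.sqrt (Int.gcd γ (Int.gcd μ ((p ^ (k + 1) : ℕ) : ℤ)) * (p ^ (k + 1) : ℕ)) := by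
        refine Real.sqrt_le_sqrt (le_mul_of_one_le_left (by positivity) ?_)
        exact_mod_cast gcd_gcd_pos (NeZero.ne (p ^ (k + 1))) γ μ
      refine le_trans ?_ (mul_le_mul_of_nonneg_left hg (by norm_num))
      obtain rfl | hk := Nat.eq_zero_or_pos k
      · have hq : ∀ (q : ℕ) [NeZero q], q = p →
            ‖inverseSquareSum q γ μ‖ ≤ 54 * Real.sqrt q := by
          rintro q _ rfl
          have := norm_inverseSquareSum_prime_le hor
          have := Real.sqrt_nonneg q
          linarith
        exact hq (p ^ (0 + 1)) (pow_one p)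
      · refine norm_sum_unitPhase_prime_pow_le (dvd_pow_self p (by omega)) (by omega)
          (ZMod.isPrimitive_stdAddChar _) ?_
        rw [map_intCast, map_intCast]
        exact hor

theorem inverseSquareSum_mul {m n : ℕ} [NeZero m] [NeZero n] [NeZero (m * n)]
    (hmn : m.Coprime n) {a b : ℤ} (hab : a * n + b * m = 1) (γ μ : ℤ) :
    inverseSquareSum (m * n) γ μ =
      inverseSquareSum m (a * γ) (a * μ) * inverseSquareSum n (b * γ) (b * μ) := by
  let e := ZMod.chineseRemainder hmn
  let f : ZMod (m * n) →+* ZMod m := (RingHom.fst _ _).comp e.toRingHom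
  let g : ZMod (m * n) →+* ZMod n := (RingHom.snd _ _).comp e.toRingHom
  let E : (ZMod (m * n))ˣ ≃* (ZMod m)ˣ × (ZMod n)ˣ :=
    (Units.mapEquiv e.toMulEquiv).trans MulEquiv.prodUnits
  have hchar : ∀ x : ZMod (m * n), (ZMod.stdAddChar x : ℂ) =
      ZMod.stdAddChar ((a : ZMod m) * f x) * ZMod.stdAddChar ((b : ZMod n) * g x) := by
    intro x
    obtain ⟨z, rfl⟩ := ZMod.intCast_surjective x
    rw [map_intCast f, map_intCast g, ← Int.cast_mul, ← Int.cast_mul, ZMod.stdAddChar_coe,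
      ZMod.stdAddChar_coe, ZMod.stdAddChar_coe, ← Complex.exp_add]
    have h1 : (m : ℂ) ≠ 0 := by exact_mod_cast NeZero.ne m
    have h2 : (n : ℂ) ≠ 0 := by exact_mod_cast NeZero.ne n
    have h3 : (a : ℂ) * n + b * m = 1 := by exact_mod_cast hab
    congr 1
    push_cast
    field_simp
    linear_combination -(z : ℂ) * h3
  have hf : ∀ u : (ZMod (m * n))ˣ, f u = ((E u).1 : (ZMod m)ˣ) := fun u => rfl
  have hg : ∀ u : (ZMod (m * n))ˣ, g u = ((E u).2 : (ZMod n)ˣ) := fun u => rfl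
  rw [inverseSquareSum, inverseSquareSum, inverseSquareSum, Finset.sum_mul_sum,
    ← Fintype.sum_prod_type', ← Equiv.sum_comp E.toEquiv]
  refine Finset.sum_congr rfl fun u _ => ?_
  rw [hchar]
  congr 2
  · simp only [unitPhase, map_add, map_mul, map_pow, map_intCast, hf, map_inv, Prod.fst_inv,
      MulEquiv.toEquiv_eq_coe, EquivLike.coe_coe]
    push_cast
    ring
  · simp only [unitPhase, map_add, map_mul, map_pow, map_intCast, hg, map_inv, Prod.snd_inv,
      MulEquiv.toEquiv_eq_coe, EquivLike.coe_coe]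
    push_cast
    ring

theorem gcd_gcd_mul_le {m n : ℕ} (hm : m ≠ 0) (hn : n ≠ 0) (hmn : m.Coprime n) {a b : ℤ}
    (hab : a * n + b * m = 1) (γ μ : ℤ) :
    Int.gcd (a * γ) (Int.gcd (a * μ) (m : ℤ)) * Int.gcd (b * γ) (Int.gcd (b * μ) (n : ℤ)) ≤
      Int.gcd γ (Int.gcd μ ((m * n : ℕ) : ℤ)) := by
  have key : ∀ (m : ℕ) (a : ℤ), IsCoprime (m : ℤ) a →
      ((Int.gcd (a * γ) (Int.gcd (a * μ) (m : ℤ)) : ℕ) : ℤ) ∣ m ∧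
      ((Int.gcd (a * γ) (Int.gcd (a * μ) (m : ℤ)) : ℕ) : ℤ) ∣ γ ∧
      ((Int.gcd (a * γ) (Int.gcd (a * μ) (m : ℤ)) : ℕ) : ℤ) ∣ μ := by
    intro m a h
    have h1 := Int.gcd_dvd_left (a * γ) ((Int.gcd (a * μ) (m : ℤ) : ℕ) : ℤ)
    have h2 := Int.gcd_dvd_right (a * γ) ((Int.gcd (a * μ) (m : ℤ) : ℕ) : ℤ)
    have h3 := h2.trans (Int.gcd_dvd_left (a * μ) (m : ℤ))
    have h4 := h2.trans (Int.gcd_dvd_right (a * μ) (m : ℤ))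
    have h5 := h.of_isCoprime_of_dvd_left h4
    exact ⟨h4, h5.dvd_of_dvd_mul_left h1, h5.dvd_of_dvd_mul_left h3⟩
  obtain ⟨h1, h2, h3⟩ := key m a ⟨b, n, by linear_combination hab⟩
  obtain ⟨h4, h5, h6⟩ := key n b ⟨a, m, by linear_combination hab⟩
  have hco := (Nat.isCoprime_iff_coprime.2 hmn).of_isCoprime_of_dvd_left h1
    |>.of_isCoprime_of_dvd_right h4
  refine Nat.le_of_dvd (gcd_gcd_pos (mul_ne_zero hm hn) γ μ) (Int.natCast_dvd_natCast.1 ?_)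
  rw [Nat.cast_mul]
  refine Int.dvd_coe_gcd (hco.mul_dvd h2 h5) (Int.dvd_coe_gcd (hco.mul_dvd h3 h6) ?_)
  rw [Nat.cast_mul]
  exact mul_dvd_mul h1 h4

theorem norm_inverseSquareSum_le (q : ℕ) :
    ∀ [NeZero q] (γ μ : ℤ), ‖inverseSquareSum q γ μ‖ ≤
      54 ^ q.primeFactors.card * Real.sqrt (Int.gcd γ (Int.gcd μ (q : ℤ)) * q) := by
  induction q using Nat.recOnPosPrimePosCoprime with
  | prime_pow p n hp hn =>
    intro _ γ μ
    rw [Nat.primeFactors_prime_pow hn.ne' hp, Finset.card_singleton, pow_one]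
    exact norm_inverseSquareSum_prime_pow_le hp n γ μ
  | zero => intro h; exact absurd rfl h.out
  | one =>
    intro _ γ μ
    refine (norm_inverseSquareSum_le_totient _ γ μ).trans ?_
    simp
  | coprime m n hm hn hmn ihm ihn =>
    intro _ γ μ
    have : NeZero m := ⟨by omega⟩
    have : NeZero n := ⟨by omega⟩
    obtain ⟨b, a, hab⟩ := Nat.isCoprime_iff_coprime.2 hmn
    have hab' : a * n + b * m = 1 := by linear_combination hab
    rw [inverseSquareSum_mul hmn hab', norm_mul, hmn.primeFactors_mul,
      Finset.card_union_of_disjoint hmn.disjoint_primeFactors, pow_add]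
    have hg : (Int.gcd (a * γ) (Int.gcd (a * μ) (m : ℤ)) *
        Int.gcd (b * γ) (Int.gcd (b * μ) (n : ℤ)) : ℝ) ≤
        Int.gcd γ (Int.gcd μ ((m * n : ℕ) : ℤ)) := by
      exact_mod_cast gcd_gcd_mul_le (NeZero.ne m) (NeZero.ne n) hmn hab' γ μ
    calc _ ≤ _ := mul_le_mul (ihm (a * γ) (a * μ)) (ihn (b * γ) (b * μ)) (norm_nonneg _)
          (by positivity)
      _ = 54 ^ m.primeFactors.card * 54 ^ n.primeFactors.card *
          Real.sqrt ((Int.gcd (a * γ) (Int.gcd (a * μ) (m : ℤ)) *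
            Int.gcd (b * γ) (Int.gcd (b * μ) (n : ℤ)) : ℝ) * ((m * n : ℕ) : ℝ)) := by
        rw [mul_mul_mul_comm, ← Real.sqrt_mul (by positivity)]
        push_cast
        ring_nf
      _ ≤ _ := by gcongr

end Modulus

theorem exists_pow_card_primeFactors_le {K : ℝ} (hK : 1 ≤ K) {ε : ℝ} (hε : 0 < ε) :
    ∃ C : ℝ, 0 < C ∧ ∀ q : ℕ, q ≠ 0 → K ^ q.primeFactors.card ≤ C * (q : ℝ) ^ ε := by
  obtain ⟨B, hB⟩ := exists_nat_ge (K ^ ε⁻¹)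
  have hK0 : 0 < K := by linarith
  refine ⟨K ^ B, by positivity, fun q hq => ?_⟩
  have h1 : ∀ p ∈ q.primeFactors, K ≤ (if p < B then K else 1) * (p : ℝ) ^ ε := by
    intro p hp
    have hp1 : (1 : ℝ) ≤ p := by exact_mod_cast (Nat.prime_of_mem_primeFactors hp).one_le
    split_ifs with h
    · exact le_mul_of_one_le_right hK0.le (Real.one_le_rpow hp1 hε.le)
    · rw [one_mul]
      have h2 : K ^ ε⁻¹ ≤ p := hB.trans (by exact_mod_cast not_lt.1 h)
      have h3 := Real.rpow_le_rpow (by positivity) h2 hε.le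
      rwa [← Real.rpow_mul hK0.le, inv_mul_cancel₀ hε.ne', Real.rpow_one] at h3
  have h2 : ∏ p ∈ q.primeFactors, (p : ℝ) ^ ε ≤ (q : ℝ) ^ ε := by
    rw [Real.finsetProd_rpow _ _ fun p _ => Nat.cast_nonneg p]
    refine Real.rpow_le_rpow (by positivity) ?_ hε.le
    rw [← Nat.cast_prod]
    exact_mod_cast Nat.le_of_dvd (Nat.pos_of_ne_zero hq) (Nat.prod_primeFactors_dvd q)
  have h3 : ∏ p ∈ q.primeFactors, (if p < B then K else 1) ≤ K ^ B := by
    rw [← Finset.prod_filter, Finset.prod_const]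
    refine pow_le_pow_right₀ hK ?_
    calc _ ≤ (Finset.range B).card := Finset.card_le_card fun p hp =>
          Finset.mem_range.2 (Finset.mem_filter.1 hp).2
      _ = B := Finset.card_range B
  calc K ^ q.primeFactors.card = ∏ p ∈ q.primeFactors, K := by rw [Finset.prod_const]
    _ ≤ ∏ p ∈ q.primeFactors, ((if p < B then K else 1) * (p : ℝ) ^ ε) :=
      Finset.prod_le_prod (fun _ _ => hK0.le) h1
    _ = _ := Finset.prod_mul_distrib
    _ ≤ K ^ B * (q : ℝ) ^ ε := by gcongr

theorem sum_eInt_eq_inverseSquareSum (q : ℕ) [NeZero q] (γ μ : ℤ) :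
    ∑ s ∈ (Finset.range q).filter (fun s => Nat.Coprime s q),
      eInt q (γ * (invMod q s : ℤ) ^ 2 + μ * s) = inverseSquareSum q γ μ := by
  symm
  refine Finset.sum_bij (fun u _ => (u : ZMod q).val) (fun u _ => ?_) (fun u _ v _ h => ?_)
    (fun s hs => ?_) (fun u _ => ?_)
  · exact Finset.mem_filter.2 ⟨Finset.mem_range.2 (ZMod.val_lt _), ZMod.val_coe_unit_coprime u⟩
  · exact Units.ext (ZMod.val_injective q h)
  · rw [Finset.mem_filter, Finset.mem_range] at hs
    exact ⟨ZMod.unitOfCoprime s hs.2, Finset.mem_univ _, by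
      rw [ZMod.coe_unitOfCoprime, ZMod.val_natCast, Nat.mod_eq_of_lt hs.1]⟩
  · rw [eInt, ← ZMod.stdAddChar_coe]
    simp [unitPhase, invMod]

/-- For every `ε > 0` there is `C > 0` such that for every `q ≥ 1` and all integers `γ, μ`,
`|∑_{s mod q, (s,q)=1} e_q(γ s̄² + μ s)| ≤ C (γ,μ,q)^{1/2} q^{1/2+ε}`. -/
theorem quadratic_inverse_expsum_bound :
    ∀ ε : ℝ, 0 < ε → ∃ C : ℝ, 0 < C ∧ ∀ q : ℕ, 1 ≤ q → ∀ γ μ : ℤ,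
      ‖∑ s ∈ (Finset.range q).filter (fun s => Nat.Coprime s q),
          eInt q (γ * (invMod q s : ℤ) ^ 2 + μ * s)‖ ≤
        C * (Int.gcd γ (Int.gcd μ (q : ℤ)) : ℝ) ^ ((1 : ℝ) / 2) *
          (q : ℝ) ^ ((1 : ℝ) / 2 + ε) := by
  intro ε hε
  obtain ⟨C, hC, h⟩ := exists_pow_card_primeFactors_le (K := 54) (by norm_num) hε
  refine ⟨C, hC, fun q hq γ μ => ?_⟩
  have hq0 : q ≠ 0 := by omega
  have : NeZero q := ⟨hq0⟩
  have hqpos : (0 : ℝ) < q := by exact_mod_cast hq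
  rw [sum_eInt_eq_inverseSquareSum]
  refine (norm_inverseSquareSum_le q γ μ).trans ?_
  refine (mul_le_mul_of_nonneg_right (h q hq0) (Real.sqrt_nonneg _)).trans_eq ?_
  rw [Real.sqrt_mul (by positivity), Real.sqrt_eq_rpow, Real.sqrt_eq_rpow, Real.rpow_add hqpos]
  ring
end

section
/- For every ε > 0 there exists C > 0 such that for every integer q ≥ 1, all integers a₁, a₂, and every polynomial P with integer coefficients satisfying P(0) = 1, one has | ∑_{s = 0}^{q−1} e_q( a₁ s + a₂ s² P(s q*) ) | ≤ C gcd(a₁, a₂, q)^{1/2} q^{1/2 + ε}, where q* denotes the radical of q (the product of the distinct prime factors of q) and the constant C depends only on ε (not on P, a₁, a₂ or q). -/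
/-- The radical of `n`: the product of its distinct prime factors. -/
def rad (n : ℕ) : ℕ := ∏ p ∈ n.primeFactors, p

open Polynomial in
/-- Divided differences of an integer polynomial are given by integer polynomials. -/
lemma exists_polynomial_forward_difference (E : ℤ[X]) (h : ℤ) :
    ∃ D : ℤ[X], ∀ x, E.eval (x + h) - E.eval x = h * D.eval x := by
  obtain ⟨D, hD⟩ := sub_dvd_eval_sub (X + C h) X (E.map C)
  refine ⟨D, fun x => ?_⟩
  have hcomp : ∀ p, (E.map C).eval p = E.comp p := fun p => eval_map C p
  have := congrArg (eval x) hD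
  simpa [hcomp, eval_comp] using this

open Polynomial in
lemma exists_eval_eq_add_mul (P : ℤ[X]) :
    ∃ Q : ℤ[X], ∀ x, P.eval x = P.eval 0 + x * Q.eval x := by
  refine ⟨P.divX, fun x => ?_⟩
  have := congrArg (eval x) (divX_mul_X_add P)
  simp only [eval_add, eval_mul, eval_X, eval_C, coeff_zero_eq_eval_zero] at this
  linarith

lemma prime_dvd_rad {p q : ℕ} (hp : p.Prime) (hq : q ≠ 0) (h : p ∣ q) : p ∣ rad q :=
  Finset.dvd_prod_of_mem (fun p => p) (Nat.mem_primeFactors.2 ⟨hp, h, hq⟩)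

lemma isCoprime_add_rad_mul {q : ℕ} (hq : q ≠ 0) {b : ℤ} (hb : IsCoprime b q) (z : ℤ) :
    IsCoprime (b + rad q * z) q := by
  rw [Int.isCoprime_iff_gcd_eq_one] at hb ⊢
  by_contra hne
  obtain ⟨p, hp, hdvd⟩ := Nat.exists_prime_and_dvd hne
  have h1 : (p : ℤ) ∣ b + rad q * z :=
    (Int.natCast_dvd_natCast.2 hdvd).trans (Int.gcd_dvd_left _ _)
  have h2 : (p : ℤ) ∣ q := (Int.natCast_dvd_natCast.2 hdvd).trans (Int.gcd_dvd_right _ _)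
  have h3 : (p : ℤ) ∣ rad q :=
    Int.natCast_dvd_natCast.2 (prime_dvd_rad hp hq (Int.natCast_dvd_natCast.1 h2))
  have h4 : (p : ℤ) ∣ b := (Int.dvd_add_left (h3.mul_right z)).1 h1
  have h5 := Int.dvd_coe_gcd h4 h2
  rw [hb] at h5
  exact hp.one_lt.ne' (by exact_mod_cast Int.eq_one_of_dvd_one (by positivity) h5)

open Polynomial in
lemma forward_difference_of_odd {q : ℕ} (hq : Odd q) (P : ℤ[X]) (hP : P.eval 0 = 1) (i k : ℤ) :
    ∃ φ : ℤ → ℤ,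
      (∀ u v, ∃ W : ℤ, IsCoprime W q ∧ φ u - φ v = (u - v) * W) ∧
      ∀ u, (2 * (u + k) + i) ^ 2 * P.eval ((2 * (u + k) + i) * rad q) -
        (2 * u + i) ^ 2 * P.eval ((2 * u + i) * rad q) = 2 * k * φ u := by
  obtain ⟨Q, hQ⟩ := exists_eval_eq_add_mul P
  obtain ⟨D, hD⟩ := exists_polynomial_forward_difference
    (X ^ 3 * Q.comp (X * C (rad q : ℤ))) (2 * k)
  have h2 : IsCoprime (2 : ℤ) q := by
    exact_mod_cast Nat.isCoprime_iff_coprime.2 (Nat.coprime_two_left.2 hq)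
  refine ⟨fun u => 2 * (2 * u + i) + 2 * k + rad q * D.eval (2 * u + i), fun u v => ?_,
    fun u => ?_⟩
  · obtain ⟨K, hK⟩ := sub_dvd_eval_sub (2 * u + i) (2 * v + i) D
    refine ⟨2 * (2 + rad q * K), h2.mul_left
      (isCoprime_add_rad_mul hq.pos.ne' h2 K), ?_⟩
    linear_combination (rad q : ℤ) * hK
  · have := hD (2 * u + i)
    simp only [eval_mul, eval_pow, eval_X, eval_comp, eval_C] at this
    rw [hQ ((2 * (u + k) + i) * rad q), hQ ((2 * u + i) * rad q), hP]
    rw [show 2 * u + i + 2 * k = 2 * (u + k) + i by ring] at this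
    linear_combination (rad q : ℤ) * this

open Polynomial in
lemma forward_difference_of_even {q : ℕ} (hq0 : q ≠ 0) (hq : Even q) (P : ℤ[X])
    (hP : P.eval 0 = 1) (i k : ℤ) :
    ∃ c : ℤ, ∃ φ : ℤ → ℤ,
      (∀ u v, ∃ W : ℤ, IsCoprime W q ∧ φ u - φ v = (u - v) * W) ∧
      ∀ u, (2 * (u + k) + i) ^ 2 * P.eval ((2 * (u + k) + i) * rad q) -
        (2 * u + i) ^ 2 * P.eval ((2 * u + i) * rad q) = c + 8 * k * φ u := by
  obtain ⟨Q, hQ⟩ := exists_eval_eq_add_mul P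
  obtain ⟨R, hR⟩ := exists_eval_eq_add_mul Q
  set c := Q.eval 0
  obtain ⟨D, hD⟩ := exists_polynomial_forward_difference
    (X ^ 4 * R.comp (X * C (rad q : ℤ))) (2 * k)
  obtain ⟨r, hr⟩ : 2 ∣ rad q := prime_dvd_rad Nat.prime_two hq0 hq.two_dvd
  have hr' : (rad q : ℤ) = 2 * r := by exact_mod_cast hr
  choose K hK using fun u v => sub_dvd_eval_sub (2 * u + i) (2 * v + i) D
  refine ⟨2 * k * (2 * i + 2 * k + c * rad q * (3 * i ^ 2 + 6 * i * k + 4 * k ^ 2) +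
      (rad q : ℤ) ^ 2 * D.eval i),
    fun u => u * (1 + rad q * (3 * c * (u + i + k) + r * K u 0)), fun u v => ?_, fun u => ?_⟩
  · refine ⟨1 + rad q * (3 * c * (u + v + i + k) + r * K u v),
      isCoprime_add_rad_mul hq0 isCoprime_one_left _, ?_⟩
    have h1 := hK u v
    have h2 := hK u 0
    have h3 := hK v 0
    have h4 : u * K u 0 - v * K v 0 = (u - v) * K u v := by linarith
    linear_combination (rad q : ℤ) * r * h4
  · have := hD (2 * u + i)
    have h2 := hK u 0
    simp only [eval_mul, eval_pow, eval_X, eval_comp, eval_C] at this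
    rw [hQ ((2 * (u + k) + i) * rad q), hQ ((2 * u + i) * rad q), hP,
      hR ((2 * (u + k) + i) * rad q), hR ((2 * u + i) * rad q)]
    rw [show 2 * u + i + 2 * k = 2 * (u + k) + i by ring] at this
    simp only [mul_zero, zero_add] at h2
    rw [hr'] at *
    linear_combination (2 * r : ℤ) ^ 2 * this + (2 * r : ℤ) ^ 2 * 2 * k * h2

lemma card_filter_mul_eq_zero_le {q : ℕ} [NeZero q] (A : ℤ) :
    (Finset.univ.filter fun k : ZMod q => (A : ZMod q) * k = 0).card ≤ Int.gcd A q := by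
  have hpos : 0 < Int.gcd A q := Int.gcd_pos_of_ne_zero_right _ (by exact_mod_cast NeZero.ne q)
  refine le_trans (Finset.card_le_card fun k hk => ?_)
    (IsAddCyclic.card_nsmul_eq_zero_le (α := ZMod q) hpos)
  simp only [Finset.mem_filter, Finset.mem_univ, true_and] at hk ⊢
  have h := congrArg (Int.cast : ℤ → ZMod q) (Int.gcd_eq_gcd_ab A q)
  push_cast at h
  rw [nsmul_eq_mul, h, add_mul, CharP.cast_eq_zero (ZMod q) q, mul_right_comm, hk]
  ring

open ZMod in
/-- Weyl differencing: if each difference `g (u + k) - g u` is a constant plus `A * k` times a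
permutation of `ZMod q`, then the exponential sum of `g` is controlled by `gcd(A, q)`. -/
lemma norm_sq_sum_stdAddChar_le {q : ℕ} [NeZero q] (A : ℤ) (g : ZMod q → ZMod q)
    (hg : ∀ k, ∃ c, ∃ φ : ZMod q → ZMod q, Function.Injective φ ∧
      ∀ u, g (u + k) - g u = c + A * k * φ u) :
    ‖∑ u, stdAddChar (g u)‖ ^ 2 ≤ q * (Int.gcd A q : ℝ) := by
  have hsq : ((‖∑ u, stdAddChar (g u)‖ ^ 2 : ℝ) : ℂ) =
      ∑ k, ∑ u, stdAddChar (g (u + k) - g u) := by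
    push_cast
    rw [← Complex.mul_conj', map_sum, Finset.sum_mul_sum, Finset.sum_comm]
    conv_rhs => rw [Finset.sum_comm]
    refine Finset.sum_congr rfl fun u _ => ?_
    rw [← Equiv.sum_comp (Equiv.addLeft u)]
    refine Finset.sum_congr rfl fun k _ => ?_
    rw [sub_eq_add_neg, AddChar.map_add_eq_mul, AddChar.map_neg_eq_conj]
    rfl
  have hinner : ∀ k : ZMod q, ‖∑ u, stdAddChar (g (u + k) - g u)‖ =
      if (A : ZMod q) * k = 0 then (q : ℝ) else 0 := by
    intro k
    obtain ⟨c, φ, hφ, h⟩ := hg k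
    have hb : Function.Bijective φ := Finite.injective_iff_bijective.1 hφ
    calc _ = ‖stdAddChar c * ∑ u, stdAddChar (φ u * ((A : ZMod q) * k))‖ := by
          simp_rw [h, AddChar.map_add_eq_mul, Finset.mul_sum, mul_comm (φ _)]
      _ = ‖∑ u : ZMod q, stdAddChar (u * ((A : ZMod q) * k))‖ := by
          rw [norm_mul, AddChar.norm_apply, one_mul,
            hb.sum_comp (fun u => stdAddChar (u * ((A : ZMod q) * k)))]
      _ = _ := by
          rw [AddChar.sum_mulShift _ (isPrimitive_stdAddChar q), ZMod.card]
          split_ifs <;> simp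
  calc ‖∑ u, stdAddChar (g u)‖ ^ 2 = ‖((‖∑ u, stdAddChar (g u)‖ ^ 2 : ℝ) : ℂ)‖ := by
        rw [Complex.norm_real, Real.norm_of_nonneg (by positivity)]
    _ ≤ ∑ k : ZMod q, if (A : ZMod q) * k = 0 then (q : ℝ) else 0 := by
        rw [hsq]
        exact (norm_sum_le _ _).trans (Finset.sum_le_sum fun k _ => (hinner k).le)
    _ = q * ((Finset.univ.filter fun k : ZMod q => (A : ZMod q) * k = 0).card : ℝ) := by
        rw [← Finset.sum_filter, Finset.sum_const, nsmul_eq_mul, mul_comm]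
    _ ≤ _ := by
        gcongr
        exact card_filter_mul_eq_zero_le A

lemma sum_range_natCast_zmod {q : ℕ} [NeZero q] (h : ZMod q → ℂ) :
    ∑ s ∈ Finset.range q, h s = ∑ x, h x :=
  Finset.sum_bij' (fun s _ => (s : ZMod q)) (fun x _ => x.val) (by simp)
    (fun x _ => Finset.mem_range.2 x.val_lt)
    (fun s hs => ZMod.val_cast_of_lt (Finset.mem_range.1 hs)) (by simp) (by simp)

lemma sum_zmod_two_mul_add {q : ℕ} [NeZero q] (h : ZMod q → ℂ) :
    ∑ u, h (2 * u + ((0 : ℤ) : ZMod q)) + ∑ u, h (2 * u + ((1 : ℤ) : ZMod q)) = 2 * ∑ x, h x := by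
  have hpairs : ∀ n : ℕ, ∑ s ∈ Finset.range (n + n), h s =
      ∑ u ∈ Finset.range n, h (2 * (u : ZMod q) + (0 : ℤ)) +
        ∑ u ∈ Finset.range n, h (2 * (u : ZMod q) + (1 : ℤ)) := by
    intro n
    induction n with
    | zero => simp
    | succ n ih =>
      rw [show n + 1 + (n + 1) = n + n + 1 + 1 by ring, Finset.sum_range_succ,
        Finset.sum_range_succ, ih, Finset.sum_range_succ, Finset.sum_range_succ]
      push_cast
      rw [two_mul, add_zero]
      ring
  rw [← sum_range_natCast_zmod fun u => h (2 * u + ((0 : ℤ) : ZMod q)),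
    ← sum_range_natCast_zmod fun u => h (2 * u + ((1 : ℤ) : ZMod q)), ← hpairs q, Finset.sum_range_add]
  simp only [Nat.cast_add, CharP.cast_eq_zero, zero_add]
  rw [sum_range_natCast_zmod h]
  ring

open ZMod Polynomial in
lemma norm_sq_sum_progression_le {q : ℕ} [NeZero q] (a₁ a₂ : ℤ) (P : ℤ[X])
    (hP : P.eval 0 = 1) (i : ℤ) :
    ‖∑ u : ZMod q, stdAddChar (N := q) (a₁ * (2 * u + i) + a₂ * ((2 * u + i) ^ 2 *
      (P.map (Int.castRingHom (ZMod q))).eval ((2 * u + i) * rad q)))‖ ^ 2 ≤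
      q * (8 * (Int.gcd a₂ q : ℝ)) := by
  have hq0 : q ≠ 0 := NeZero.ne q
  obtain ⟨B, hB, hdiff⟩ : ∃ B : ℤ, B ∣ 8 ∧ ∀ k : ℤ, ∃ c : ℤ, ∃ φ : ℤ → ℤ,
      (∀ u v, ∃ W : ℤ, IsCoprime W q ∧ φ u - φ v = (u - v) * W) ∧
      ∀ u, (2 * (u + k) + i) ^ 2 * P.eval ((2 * (u + k) + i) * rad q) -
        (2 * u + i) ^ 2 * P.eval ((2 * u + i) * rad q) = c + B * k * φ u := by
    rcases Nat.even_or_odd q with hq | hq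
    · exact ⟨8, dvd_rfl, forward_difference_of_even hq0 hq P hP i⟩
    · refine ⟨2, by norm_num, fun k => ⟨0, ?_⟩⟩
      simpa only [zero_add] using forward_difference_of_odd hq P hP i k
  refine (norm_sq_sum_stdAddChar_le (B * a₂) _ fun k => ?_).trans ?_
  · obtain ⟨k, rfl⟩ := ZMod.intCast_surjective k
    obtain ⟨c, φ, hφ, h⟩ := hdiff k
    refine ⟨a₁ * (2 * k) + a₂ * c, fun u => (φ u.val : ZMod q), fun u v huv => ?_, fun u => ?_⟩
    · obtain ⟨W, hW, hd⟩ := hφ u.val v.val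
      have hd' := congrArg (Int.cast : ℤ → ZMod q) hd
      push_cast at hd'
      simp only at huv
      rw [huv, sub_self] at hd'
      have hunit : IsUnit (W : ZMod q) := (ZMod.coe_int_isUnit_iff_isCoprime W q).2 hW.symm
      have := hunit.mul_left_eq_zero.1 hd'.symm
      simpa [sub_eq_zero] using this
    · have h' := congrArg (Int.cast : ℤ → ZMod q) (h u.val)
      have hev : ∀ x : ℤ, ((P.eval x : ℤ) : ZMod q) =
          (P.map (Int.castRingHom (ZMod q))).eval (x : ZMod q) := fun x => by
        simp
      push_cast [hev] at h'
      rw [ZMod.natCast_zmod_val] at h'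
      push_cast
      linear_combination (a₂ : ZMod q) * h'
  · gcongr
    have hdvd : Int.gcd (B * a₂) q ∣ 8 * Int.gcd a₂ q := by
      have h1 : Int.gcd (B * a₂) q ∣ Int.gcd (8 * a₂) (8 * q) :=
        Int.gcd_dvd_gcd_of_dvd_left _ (mul_dvd_mul_right hB _) |>.trans
          (Int.gcd_dvd_gcd_of_dvd_right _ (dvd_mul_left _ _))
      simpa [Int.gcd_mul_left] using h1
    have hpos : 0 < Int.gcd a₂ q := Int.gcd_pos_of_ne_zero_right _ (by exact_mod_cast hq0)
    exact_mod_cast Nat.le_of_dvd (by positivity) hdvd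

open ZMod Polynomial in
/-- The sum vanishes unless `gcd(a₂, q)` divides `a₁`. -/
lemma gcd_dvd_of_sum_ne_zero {q : ℕ} [NeZero q] (a₁ a₂ : ℤ) (F : (ZMod q)[X])
    (hne : ∑ s : ZMod q, stdAddChar (N := q) (a₁ * s + a₂ * F.eval s) ≠ 0) :
    (Int.gcd a₂ q : ℤ) ∣ a₁ := by
  have hq0 : (q : ℤ) ≠ 0 := by exact_mod_cast NeZero.ne q
  obtain ⟨t, ht⟩ := Int.gcd_dvd_right a₂ (q : ℤ)
  obtain ⟨b, hb⟩ := Int.gcd_dvd_left a₂ (q : ℤ)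
  set d := Int.gcd a₂ q
  have ha₂t : (a₂ : ZMod q) * t = 0 := by
    rw [← Int.cast_mul, ZMod.intCast_zmod_eq_zero_iff_dvd]
    exact ⟨b, by linear_combination t * hb - b * ht⟩
  have hshift : ∑ s : ZMod q, stdAddChar (N := q) (a₁ * s + a₂ * F.eval s) =
      stdAddChar (N := q) (a₁ * t) *
        ∑ s : ZMod q, stdAddChar (N := q) (a₁ * s + a₂ * F.eval s) := by
    rw [Finset.mul_sum]
    nth_rw 1 [← Equiv.sum_comp (Equiv.addRight (t : ZMod q))]
    refine Finset.sum_congr rfl fun s _ => ?_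
    rw [← AddChar.map_add_eq_mul]
    obtain ⟨K, hK⟩ := sub_dvd_eval_sub (s + t) s F
    congr 1
    simp only [Equiv.coe_addRight]
    linear_combination (a₂ : ZMod q) * hK + K * ha₂t
  have h1 : stdAddChar (N := q) (a₁ * t) = 1 := by
    refine mul_right_cancel₀ hne ?_
    rw [one_mul, ← hshift]
  have h2 : (a₁ : ZMod q) * t = 0 :=
    injective_stdAddChar (h1.trans (AddChar.map_zero_eq_one _).symm)
  rw [← Int.cast_mul, ZMod.intCast_zmod_eq_zero_iff_dvd, ht] at h2
  refine Int.dvd_of_mul_dvd_mul_right ?_ h2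
  rintro rfl
  exact hq0 (ht.trans (mul_zero _))

/-- For every `ε > 0` there is `C > 0`, depending only on `ε`, such that for every `q ≥ 1`,
all integers `a₁, a₂` and every integer polynomial `P` with `P(0) = 1`,
`|∑_{s=0}^{q-1} e_q(a₁ s + a₂ s² P(s q*))| ≤ C (a₁,a₂,q)^{1/2} q^{1/2+ε}`. -/
theorem twisted_gauss_sum_bound :
    ∀ ε : ℝ, 0 < ε → ∃ C : ℝ, 0 < C ∧ ∀ q : ℕ, 1 ≤ q → ∀ a₁ a₂ : ℤ,
      ∀ P : Polynomial ℤ, P.eval 0 = 1 →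
      ‖∑ s ∈ Finset.range q, eInt q (a₁ * s + a₂ * (s : ℤ) ^ 2 * P.eval ((s : ℤ) * (rad q : ℤ)))‖ ≤
        C * (Int.gcd a₁ (Int.gcd a₂ (q : ℤ)) : ℝ) ^ ((1 : ℝ) / 2) *
          (q : ℝ) ^ ((1 : ℝ) / 2 + ε) := by
  intro ε hε
  refine ⟨3, by norm_num, fun q hq a₁ a₂ P hP => ?_⟩
  have : NeZero q := ⟨by lia⟩
  have hq1 : (1 : ℝ) ≤ q := by exact_mod_cast hq
  set Pq := P.map (Int.castRingHom (ZMod q))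
  set f : ZMod q → ℂ := fun s =>
    ZMod.stdAddChar (N := q) (a₁ * s + a₂ * (s ^ 2 * Pq.eval (s * rad q))) with hf
  have hsum : ∑ s ∈ Finset.range q,
      eInt q (a₁ * s + a₂ * (s : ℤ) ^ 2 * P.eval ((s : ℤ) * (rad q : ℤ))) = ∑ x, f x := by
    rw [← sum_range_natCast_zmod]
    refine Finset.sum_congr rfl fun s _ => ?_
    have hev : ((P.eval ((s : ℤ) * (rad q : ℤ)) : ℤ) : ZMod q) =
        Pq.eval ((s : ZMod q) * rad q) := by
      have := Polynomial.eval_intCast_map (Int.castRingHom (ZMod q)) P ((s : ℤ) * (rad q : ℤ))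
      push_cast at this
      exact this.symm
    rw [eInt, ← ZMod.stdAddChar_coe, hf]
    push_cast [hev]
    rw [mul_assoc]
  rw [hsum]
  rcases eq_or_ne (∑ x, f x) 0 with h0 | hne
  · rw [h0, norm_zero]
    positivity
  have hdvd : (Int.gcd a₂ q : ℤ) ∣ a₁ := by
    refine gcd_dvd_of_sum_ne_zero a₁ a₂
      (Polynomial.X ^ 2 * Pq.comp (Polynomial.X * Polynomial.C (rad q : ZMod q))) ?_
    simpa [Polynomial.eval_comp] using hne
  have hgcd : Int.gcd a₁ (Int.gcd a₂ (q : ℤ)) = Int.gcd a₂ q := by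
    exact_mod_cast (Int.gcd_eq_right_iff_dvd (by positivity)).2 hdvd
  rw [hgcd]
  set d : ℝ := (Int.gcd a₂ q : ℝ)
  have hprog : ∀ i : ℤ, ‖∑ u : ZMod q, f (2 * u + i)‖ ≤ 3 * √(d * q) := by
    intro i
    refine abs_le_of_sq_le_sq' ?_ (by positivity) |>.2
    rw [mul_pow, Real.sq_sqrt (by positivity)]
    refine (norm_sq_sum_progression_le a₁ a₂ P hP i).trans ?_
    nlinarith [show 0 ≤ d * q by positivity]
  have htwo : 2 * ‖∑ x, f x‖ ≤ 2 * (3 * √(d * q)) := by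
    calc 2 * ‖∑ x, f x‖ = ‖2 * ∑ x, f x‖ := by simp
      _ ≤ _ := by
        rw [← sum_zmod_two_mul_add f]
        exact (norm_add_le _ _).trans (by linarith [hprog 0, hprog 1])
  calc ‖∑ x, f x‖ ≤ 3 * √(d * q) := by linarith
    _ = 3 * d ^ ((1 : ℝ) / 2) * (q : ℝ) ^ ((1 : ℝ) / 2) := by
      rw [Real.sqrt_mul (by positivity), Real.sqrt_eq_rpow, Real.sqrt_eq_rpow, mul_assoc]
    _ ≤ _ := by
      gcongr
      linarith
end

section
/- For every ε > 0 there exists C > 0 such that for every integer q ≥ 1 and all reals K, M, N ≥ 1, the number of sextuples (k, k', m, m', n, n') of positive integers, each coprime to q, with k, k' ≤ K, M ≤ m, m' ≤ 2M, N ≤ n, n' ≤ 2N, and k m n ≡ k' m' n' (mod q), is at most C (KMNq)^{ε} · KMN · (1 + KMN/q). -/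
/-- The local factor of the divisor bound: `a + 1` is at most a constant times `p ^ (a δ)`, and the
constant is `1` once `2 ≤ p ^ δ`. -/
lemma succ_le_mul_pow_rpow {δ : ℝ} (hδ : 0 < δ) {B p : ℕ} (hB : (2 : ℝ) ^ (1 / δ) ≤ B)
    (hp : 2 ≤ p) (a : ℕ) :
    (a : ℝ) + 1 ≤ (if p < B then 1 + 1 / (δ * Real.log 2) else 1) * ((p : ℝ) ^ a) ^ δ := by
  have hp' : (2 : ℝ) ≤ p := by exact_mod_cast hp
  have hlog : 0 < δ * Real.log 2 := mul_pos hδ (Real.log_pos one_lt_two)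
  have hswap : ((p : ℝ) ^ a) ^ δ = ((p : ℝ) ^ δ) ^ a := by
    rw [← Real.rpow_natCast, ← Real.rpow_natCast, ← Real.rpow_mul (by positivity),
      ← Real.rpow_mul (by positivity), mul_comm]
  split_ifs with h
  · have h1 : 1 + a * (δ * Real.log 2) ≤ ((p : ℝ) ^ a) ^ δ := by
      calc 1 + a * (δ * Real.log 2) ≤ Real.exp (a * (δ * Real.log 2)) := by
            linarith [Real.add_one_le_exp (a * (δ * Real.log 2))]
        _ = ((2 : ℝ) ^ δ) ^ a := by
            rw [Real.exp_nat_mul, Real.rpow_def_of_pos two_pos, mul_comm δ]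
        _ ≤ _ := by rw [hswap]; gcongr
    calc (a : ℝ) + 1 ≤ (1 + 1 / (δ * Real.log 2)) * (1 + a * (δ * Real.log 2)) := by
          have h2 : 1 / (δ * Real.log 2) * (δ * Real.log 2) = 1 := by field_simp
          have h3 : 0 < 1 / (δ * Real.log 2) := by positivity
          have h4 : 0 ≤ a * (δ * Real.log 2) := by positivity
          linear_combination h3 + h4 - a * h2
      _ ≤ _ := by gcongr
  · have h2 : (2 : ℝ) ≤ (p : ℝ) ^ δ := by
      calc (2 : ℝ) = ((2 : ℝ) ^ (1 / δ)) ^ δ := by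
            rw [← Real.rpow_mul two_pos.le, one_div_mul_cancel hδ.ne', Real.rpow_one]
        _ ≤ (B : ℝ) ^ δ := by gcongr
        _ ≤ _ := by gcongr; exact not_lt.mp h
    rw [one_mul, hswap]
    calc (a : ℝ) + 1 ≤ 2 ^ a := by exact_mod_cast Nat.lt_two_pow_self
      _ ≤ _ := by gcongr

/-- The divisor bound `d(n) ≪ n ^ δ`. -/
lemma exists_card_divisors_le_mul_rpow {δ : ℝ} (hδ : 0 < δ) :
    ∃ C : ℝ, 0 < C ∧ ∀ n : ℕ, (n.divisors.card : ℝ) ≤ C * (n : ℝ) ^ δ := by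
  obtain ⟨B, hB⟩ := exists_nat_ge ((2 : ℝ) ^ (1 / δ))
  set A : ℝ := 1 + 1 / (δ * Real.log 2) with hA
  have hA1 : 1 ≤ A := by
    have := Real.log_pos one_lt_two
    rw [hA, le_add_iff_nonneg_right]; positivity
  refine ⟨A ^ B, by positivity, fun n => ?_⟩
  rcases eq_or_ne n 0 with rfl | hn
  · simp only [Nat.divisors_zero, Finset.card_empty, Nat.cast_zero]; positivity
  have hpow : (n : ℝ) ^ δ = ∏ p ∈ n.primeFactors, ((p : ℝ) ^ n.factorization p) ^ δ := by
    rw [Real.finsetProd_rpow _ _ fun _ _ => by positivity]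
    congr 1
    exact_mod_cast (Nat.prod_factorization_pow_eq_self hn).symm
  rw [Nat.card_divisors hn, hpow]
  push_cast
  calc ∏ p ∈ n.primeFactors, ((n.factorization p : ℝ) + 1)
      ≤ ∏ p ∈ n.primeFactors, (if p < B then A else 1) * ((p : ℝ) ^ n.factorization p) ^ δ :=
        Finset.prod_le_prod (fun _ _ => by positivity) fun p hp =>
          succ_le_mul_pow_rpow hδ hB (Nat.prime_of_mem_primeFactors hp).two_le _
    _ ≤ _ := by
      rw [Finset.prod_mul_distrib]
      gcongr
      rw [← Finset.prod_filter, Finset.prod_const]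
      refine pow_le_pow_right₀ hA1 ?_
      calc _ ≤ (Finset.range B).card := Finset.card_le_card fun p hp => by
            simpa using (Finset.mem_filter.mp hp).2
        _ = B := Finset.card_range B

/-- The pairs `(a, b)` with `1 ≤ a ≤ X`, `b ≤ X` and `b ≡ a [MOD q]`. -/
def congruentPairs (q X : ℕ) : Finset (Σ _ : ℕ, ℕ) :=
  (Finset.Icc 1 X).sigma fun a => (Finset.range (X + 1)).filter fun b => b ≡ a [MOD q]

lemma card_congruentPairs_le {q : ℕ} (hq : 0 < q) (X : ℕ) :
    ((congruentPairs q X).card : ℝ) ≤ X * (((X : ℝ) + 1) / q + 1) := by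
  have hfib (a : ℕ) :
      (((Finset.range (X + 1)).filter fun b => b ≡ a [MOD q]).card : ℝ) ≤ ((X : ℝ) + 1) / q + 1 := by
    rw [← Nat.count_eq_card_filter_range, Nat.count_modEq_card _ hq]
    push_cast
    refine add_le_add ?_ (by split_ifs <;> norm_num)
    exact_mod_cast Nat.cast_div_le (α := ℝ) (m := X + 1) (n := q)
  rw [congruentPairs, Finset.card_sigma]
  push_cast
  refine (Finset.sum_le_card_nsmul _ _ _ fun a _ => hfib a).trans_eq ?_
  rw [nsmul_eq_mul, Nat.card_Icc, Nat.add_sub_cancel]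

/-- Pairs of congruent integers up to `X`, each with two of its divisors. -/
def congruentPairsWithDivisors (q X : ℕ) : Finset (Σ _ : (Σ _ : ℕ, ℕ), (ℕ × ℕ) × ℕ × ℕ) :=
  (congruentPairs q X).sigma fun x =>
    (x.1.divisors ×ˢ x.1.divisors) ×ˢ x.2.divisors ×ˢ x.2.divisors

lemma card_congruentPairsWithDivisors_le {q : ℕ} (hq : 0 < q) {X : ℕ} {D : ℝ}
    (hD : ∀ n ≤ X, (n.divisors.card : ℝ) ≤ D) :
    ((congruentPairsWithDivisors q X).card : ℝ) ≤ X * (((X : ℝ) + 1) / q + 1) * D ^ 4 := by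
  have hD0 : 0 ≤ D := (Nat.cast_nonneg _).trans (hD 0 (Nat.zero_le X))
  rw [congruentPairsWithDivisors, Finset.card_sigma]
  push_cast
  refine (Finset.sum_le_card_nsmul _ _ (D ^ 4) fun x hx => ?_).trans ?_
  · simp only [congruentPairs, Finset.mem_sigma, Finset.mem_Icc, Finset.mem_filter,
      Finset.mem_range] at hx
    simp only [Finset.card_product, Nat.cast_mul]
    calc _ ≤ (D * D) * (D * D) := by
          have h1 := hD x.1 (by omega)
          have h2 := hD x.2 (by omega)
          gcongr
      _ = D ^ 4 := by ring
  · rw [nsmul_eq_mul]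
    gcongr
    exact card_congruentPairs_le hq X

/-- Recording both products and the first two factors of each is injective on the sextuples of
positive integers, so those with congruent products up to `X` are few. -/
lemma natCard_le_card_congruentPairsWithDivisors {q X : ℕ} {P : ℕ × ℕ × ℕ × ℕ × ℕ × ℕ → Prop}
    (hP : ∀ k k' m m' n n', P (k, k', m, m', n, n') →
      0 < k * m * n ∧ k * m * n ≤ X ∧ 0 < k' * m' * n' ∧ k' * m' * n' ≤ X ∧
        k * m * n ≡ k' * m' * n' [MOD q]) :
    Nat.card {t // P t} ≤ (congruentPairsWithDivisors q X).card := by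
  rw [← Nat.card_eq_finsetCard]
  refine Nat.card_le_card_of_injective
    (fun t => ⟨⟨⟨t.1.1 * t.1.2.2.1 * t.1.2.2.2.2.1, t.1.2.1 * t.1.2.2.2.1 * t.1.2.2.2.2.2⟩,
      (t.1.1, t.1.2.2.1), (t.1.2.1, t.1.2.2.2.1)⟩, ?_⟩) ?_
  · obtain ⟨⟨k, k', m, m', n, n'⟩, ht⟩ := t
    obtain ⟨h1, h2, h3, h4, h5⟩ := hP _ _ _ _ _ _ ht
    simp only [congruentPairsWithDivisors, congruentPairs, Finset.mem_sigma, Finset.mem_Icc,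
      Finset.mem_filter, Finset.mem_range, Finset.mem_product, Nat.mem_divisors]
    refine ⟨⟨⟨h1, h2⟩, Nat.lt_succ_of_le h4, h5.symm⟩,
      ⟨⟨?_, h1.ne'⟩, ?_, h1.ne'⟩, ⟨?_, h3.ne'⟩, ?_, h3.ne'⟩
    · exact ⟨m * n, by ring⟩
    · exact ⟨k * n, by ring⟩
    · exact ⟨m' * n', by ring⟩
    · exact ⟨k' * n', by ring⟩
  · rintro ⟨⟨k, k', m, m', n, n'⟩, ht⟩ ⟨⟨l, l', r, r', s, s'⟩, hu⟩ h
    obtain ⟨h1, -, h3, -, -⟩ := hP _ _ _ _ _ _ ht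
    simp only [Subtype.mk.injEq, Sigma.mk.injEq, heq_eq_eq, Prod.mk.injEq] at h
    obtain ⟨⟨hn, hn'⟩, ⟨rfl, rfl⟩, rfl, rfl⟩ := h
    have e : n = s := Nat.eq_of_mul_eq_mul_left (Nat.pos_of_mul_pos_right h1) hn
    have e' : n' = s' := Nat.eq_of_mul_eq_mul_left (Nat.pos_of_mul_pos_right h3) hn'
    rw [Subtype.mk.injEq, e, e']

/-- For every `ε > 0` there is `C > 0` such that for every `q ≥ 1` and reals `K, M, N ≥ 1`,
the number of sextuples `(k,k',m,m',n,n')` of positive integers coprime to `q` with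
`k,k' ≤ K`, `M ≤ m,m' ≤ 2M`, `N ≤ n,n' ≤ 2N` and `kmn ≡ k'm'n' (mod q)` is at most
`C (KMNq)^ε · KMN · (1 + KMN/q)`. -/
theorem congruence_sextuple_count :
    ∀ ε : ℝ, 0 < ε → ∃ C : ℝ, 0 < C ∧ ∀ q : ℕ, 1 ≤ q → ∀ K M N : ℝ,
      1 ≤ K → 1 ≤ M → 1 ≤ N →
      (Nat.card {t : ℕ × ℕ × ℕ × ℕ × ℕ × ℕ //
        (0 < t.1 ∧ 0 < t.2.1 ∧ 0 < t.2.2.1 ∧ 0 < t.2.2.2.1 ∧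
          0 < t.2.2.2.2.1 ∧ 0 < t.2.2.2.2.2) ∧
        (Nat.Coprime t.1 q ∧ Nat.Coprime t.2.1 q ∧ Nat.Coprime t.2.2.1 q ∧
          Nat.Coprime t.2.2.2.1 q ∧ Nat.Coprime t.2.2.2.2.1 q ∧ Nat.Coprime t.2.2.2.2.2 q) ∧
        ((t.1 : ℝ) ≤ K ∧ (t.2.1 : ℝ) ≤ K ∧
          M ≤ (t.2.2.1 : ℝ) ∧ (t.2.2.1 : ℝ) ≤ 2 * M ∧
          M ≤ (t.2.2.2.1 : ℝ) ∧ (t.2.2.2.1 : ℝ) ≤ 2 * M ∧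
          N ≤ (t.2.2.2.2.1 : ℝ) ∧ (t.2.2.2.2.1 : ℝ) ≤ 2 * N ∧
          N ≤ (t.2.2.2.2.2 : ℝ) ∧ (t.2.2.2.2.2 : ℝ) ≤ 2 * N) ∧
        t.1 * t.2.2.1 * t.2.2.2.2.1 ≡ t.2.1 * t.2.2.2.1 * t.2.2.2.2.2 [MOD q]} : ℝ) ≤
      C * (K * M * N * q) ^ ε * (K * M * N) * (1 + K * M * N / q) := by
  intro ε hε
  obtain ⟨C, hC, hdiv⟩ := exists_card_divisors_le_mul_rpow (δ := ε / 4) (by positivity)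
  refine ⟨32 * 4 ^ ε * C ^ 4, by positivity, fun q hq K M N hK hM hN => ?_⟩
  set Z := K * M * N with hZ
  have hZ1 : 1 ≤ Z := one_le_mul_of_one_le_of_one_le (one_le_mul_of_one_le_of_one_le hK hM) hN
  have hq1 : (1 : ℝ) ≤ q := by exact_mod_cast hq
  have hX : (⌊4 * Z⌋₊ : ℝ) ≤ 4 * Z := Nat.floor_le (by positivity)
  have hprod {k m n : ℕ} (hk : (k : ℝ) ≤ K) (hm : (m : ℝ) ≤ 2 * M) (hn : (n : ℝ) ≤ 2 * N) :
      k * m * n ≤ ⌊4 * Z⌋₊ := by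
    refine Nat.le_floor ?_
    push_cast
    calc (k : ℝ) * m * n ≤ K * (2 * M) * (2 * N) := by gcongr
      _ = 4 * Z := by rw [hZ]; ring
  have hD (n : ℕ) (hn : n ≤ ⌊4 * Z⌋₊) : (n.divisors.card : ℝ) ≤ C * (4 * Z) ^ (ε / 4) := by
    refine (hdiv n).trans ?_
    have : (n : ℝ) ≤ 4 * Z := (Nat.cast_le.mpr hn).trans hX
    gcongr
  calc _ ≤ ((congruentPairsWithDivisors q ⌊4 * Z⌋₊).card : ℝ) := by
        refine Nat.cast_le.mpr (natCard_le_card_congruentPairsWithDivisors ?_)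
        rintro k k' m m' n n' ⟨⟨h1, h2, h3, h4, h5, h6⟩, -,
          ⟨hk, hk', -, hm, -, hm', -, hn, -, hn'⟩, hcong⟩
        exact ⟨Nat.mul_pos (Nat.mul_pos h1 h3) h5, hprod hk hm hn,
          Nat.mul_pos (Nat.mul_pos h2 h4) h6, hprod hk' hm' hn', hcong⟩
    _ ≤ ⌊4 * Z⌋₊ * (((⌊4 * Z⌋₊ : ℝ) + 1) / q + 1) * (C * (4 * Z) ^ (ε / 4)) ^ 4 :=
        card_congruentPairsWithDivisors_le hq hD
    _ ≤ (4 * Z) * (8 * Z / q + 8) * (C ^ 4 * (4 ^ ε * (Z * q) ^ ε)) := by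
        have hpow : (C * (4 * Z) ^ (ε / 4)) ^ 4 = C ^ 4 * (4 ^ ε * Z ^ ε) := by
          rw [mul_pow, ← Real.rpow_mul_natCast (by positivity),
            ← Real.mul_rpow (by positivity) (by positivity)]
          norm_num
        rw [hpow]
        gcongr
        · linarith
        · norm_num
        · exact le_mul_of_one_le_right (by positivity) hq1
    _ = 32 * 4 ^ ε * C ^ 4 * (Z * q) ^ ε * Z * (1 + Z / q) := by ring
end

section
/- Let q, ρ be positive integers with ρ | q, and let γ, μ be integers. Suppose u₁, u₂ are integers coprime to qρ with u₁ ≡ u₂ (mod q) and μ u₁ ≡ γ ū₁² (mod ρ), where x̄ denotes the multiplicative inverse of x modulo qρ. Then e_{qρ}( γ ū₁² + 2 μ u₁ ) = e_{qρ}( γ ū₂² + 2 μ u₂ ). -/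
theorem eInt_eq_of_dvd_sub {q : ℕ} (hq : 0 < q) {x y : ℤ} (h : (q : ℤ) ∣ x - y) :
    eInt q x = eInt q y := by
  obtain ⟨k, hk⟩ := h
  obtain rfl : x = y + q * k := by linarith
  have hq' : (q : ℂ) ≠ 0 := by exact_mod_cast hq.ne'
  unfold eInt
  rw [Complex.exp_eq_exp_iff_exists_int]
  refine ⟨k, ?_⟩
  push_cast
  field_simp

theorem dvd_mul_invMod_sub_one {n : ℕ} (hn : 0 < n) {x : ℤ} (h : Int.gcd x n = 1) :
    (n : ℤ) ∣ x * invMod n x - 1 := by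
  have : NeZero n := ⟨hn.ne'⟩
  rw [← ZMod.intCast_zmod_eq_zero_iff_dvd]
  unfold invMod
  push_cast
  rw [ZMod.natCast_zmod_val, ZMod.coe_int_mul_inv_eq_one (Int.isCoprime_iff_gcd_eq_one.mpr h),
    sub_self]

theorem mul_dvd_sub_of_modEq {q ρ γ μ u₁ u₂ a b : ℤ} (hdvd : ρ ∣ q)
    (ha : q * ρ ∣ u₁ * a - 1) (hb : q * ρ ∣ u₂ * b - 1) (hcong : u₁ ≡ u₂ [ZMOD q])
    (hsol : ρ ∣ μ * u₁ - γ * a ^ 2) :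
    q * ρ ∣ (γ * a ^ 2 + 2 * μ * u₁) - (γ * b ^ 2 + 2 * μ * u₂) := by
  obtain ⟨t, ht⟩ := hcong.dvd
  obtain ⟨k, hk⟩ := ha
  obtain ⟨l, hl⟩ := hb
  have hab : a - b = a * b * (q * t) + q * ρ * (b * k - a * l) := by
    linear_combination a * b * ht + b * hk - a * hl
  have hρab : ρ ∣ a - b := by
    rw [hab]
    exact dvd_add ((hdvd.mul_right t).mul_left _) ((dvd_mul_left ρ q).mul_right _)
  have hμ : ρ ∣ γ * a * b * (a + b) - 2 * μ := by
    obtain ⟨w, hw⟩ := hρab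
    obtain ⟨m, hm⟩ := hsol
    exact ⟨2 * μ * q * k - 2 * a * m - γ * a * (2 * a + b) * w, by
      linear_combination 2 * μ * hk - 2 * a * hm - γ * a * (2 * a + b) * hw⟩
  have hsplit : (γ * a ^ 2 + 2 * μ * u₁) - (γ * b ^ 2 + 2 * μ * u₂) =
      q * (γ * a * b * (a + b) - 2 * μ) * t + q * ρ * (γ * (a + b) * (b * k - a * l)) := by
    linear_combination γ * (a + b) * hab - 2 * μ * ht
  rw [hsplit]
  exact dvd_add ((mul_dvd_mul_left q hμ).mul_right t) (dvd_mul_right _ _)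

/-- If `ρ ∣ q`, `u₁ ≡ u₂ (mod q)` are coprime to `qρ` and `μ u₁ ≡ γ ū₁² (mod ρ)`, then
`e_{qρ}(γ ū₁² + 2μ u₁) = e_{qρ}(γ ū₂² + 2μ u₂)`. -/
theorem expsum_term_well_defined (q ρ : ℕ) (hq : 0 < q) (hρ : 0 < ρ) (hdvd : ρ ∣ q)
    (γ μ u₁ u₂ : ℤ) (h₁ : Int.gcd u₁ (q * ρ) = 1) (h₂ : Int.gcd u₂ (q * ρ) = 1)
    (hcong : u₁ ≡ u₂ [ZMOD (q : ℤ)])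
    (hsol : (ρ : ℤ) ∣ (μ * u₁ - γ * (invMod (q * ρ) u₁ : ℤ) ^ 2)) :
    eInt (q * ρ) (γ * (invMod (q * ρ) u₁ : ℤ) ^ 2 + 2 * μ * u₁) =
      eInt (q * ρ) (γ * (invMod (q * ρ) u₂ : ℤ) ^ 2 + 2 * μ * u₂) := by
  have hN : 0 < q * ρ := Nat.mul_pos hq hρ
  have ha := dvd_mul_invMod_sub_one hN (x := u₁) (by exact_mod_cast h₁)
  have hb := dvd_mul_invMod_sub_one hN (x := u₂) (by exact_mod_cast h₂)
  rw [Nat.cast_mul] at ha hb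
  apply eInt_eq_of_dvd_sub hN
  rw [Nat.cast_mul]
  exact mul_dvd_sub_of_modEq (Int.natCast_dvd_natCast.mpr hdvd) ha hb hcong hsol
end

section
/- Let ρ ≥ 1 be an integer, ρ* its radical (the product of its distinct prime factors), and let b₁, b₂, b₃, b₄ be integers coprime to ρ. Suppose (u, u₁, u₂, u₃, u₄) and (u', u₁', u₂', u₃', u₄') are tuples of integers coprime to ρρ* with u ≡ u' (mod ρ) and uᵢ ≡ uᵢ' (mod ρ) for each i. Then (u, u₁, …, u₄) satisfies [∑_{i=1}^{4} (u uᵢ + b̄ᵢ ūᵢ) ≡ 0 (mod ρρ*) and u uᵢ ≡ b̄ᵢ ūᵢ (mod ρ) for all i] if and only if (u', u₁', …, u₄') satisfies the same conditions, where x̄ denotes the multiplicative inverse of x modulo ρρ* and b̄ᵢ the inverse of bᵢ modulo ρρ*. -/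
/-- The defining conditions of `N₂(ρ)` on an integer lift `(u, v₁, …, v₄)`:
`∑ᵢ (u vᵢ + b̄ᵢ v̄ᵢ) ≡ 0 (mod ρρ*)` and `u vᵢ ≡ b̄ᵢ v̄ᵢ (mod ρ)`, where inverses are taken
modulo `ρρ*`. -/
def N2cond (ρ : ℕ) (b : Fin 4 → ℤ) (u : ℤ) (v : Fin 4 → ℤ) : Prop :=
  (∑ i, ((u : ZMod (ρ * rad ρ)) * (v i : ZMod (ρ * rad ρ)) +
      ((b i : ZMod (ρ * rad ρ)))⁻¹ * ((v i : ZMod (ρ * rad ρ)))⁻¹) = 0) ∧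
  ∀ i, ZMod.castHom (dvd_mul_right ρ (rad ρ)) (ZMod ρ)
        ((u : ZMod (ρ * rad ρ)) * (v i : ZMod (ρ * rad ρ))) =
      ZMod.castHom (dvd_mul_right ρ (rad ρ)) (ZMod ρ)
        (((b i : ZMod (ρ * rad ρ)))⁻¹ * ((v i : ZMod (ρ * rad ρ)))⁻¹)

theorem rad_dvd_self (n : ℕ) : rad n ∣ n := Nat.prod_primeFactors_dvd n

theorem rad_intCast_dvd {n : ℕ} {z : ℤ} (h : ∀ p : ℕ, p.Prime → p ∣ n → (p : ℤ) ∣ z) :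
    (rad n : ℤ) ∣ z := by
  rw [Int.natCast_dvd]
  refine Finset.prod_primes_dvd _ (fun p hp => (Nat.prime_of_mem_primeFactors hp).prime)
    fun p hp => ?_
  exact Int.natCast_dvd.mp
    (h p (Nat.prime_of_mem_primeFactors hp) (Nat.dvd_of_mem_primeFactors hp))

theorem natCast_sq_eq_zero_mul_rad (n : ℕ) : (n : ZMod (n * rad n)) ^ 2 = 0 := by
  rw [← Nat.cast_pow, ZMod.natCast_eq_zero_iff, sq]
  exact mul_dvd_mul_left n (rad_dvd_self n)

theorem castHom_eq_castHom_iff {m n : ℕ} (h : m ∣ n) (x y : ZMod n) :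
    ZMod.castHom h (ZMod m) x = ZMod.castHom h (ZMod m) y ↔ ∃ t, x = y + m * t := by
  constructor
  · intro hxy
    obtain ⟨a, rfl⟩ := ZMod.intCast_surjective x
    obtain ⟨c, rfl⟩ := ZMod.intCast_surjective y
    rw [map_intCast, map_intCast, eq_comm, ZMod.intCast_eq_intCast_iff_dvd_sub] at hxy
    obtain ⟨t, ht⟩ := hxy
    refine ⟨t, ?_⟩
    rw [eq_add_of_sub_eq' ht]
    push_cast
    ring
  · rintro ⟨t, rfl⟩
    rw [map_add, map_mul, map_natCast, ZMod.natCast_self, zero_mul, add_zero]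

theorem exists_intCast_eq_add_mul {m : ℕ} (n : ℕ) {a c : ℤ} (h : a ≡ c [ZMOD m]) :
    ∃ t : ZMod n, (c : ZMod n) = a + m * t := by
  obtain ⟨t, ht⟩ := h.dvd
  refine ⟨t, ?_⟩
  rw [eq_add_of_sub_eq' ht]
  push_cast
  ring

theorem mul_inv_eq_one_of_gcd_eq_one {m n : ℕ} {a : ℤ} (h : Int.gcd a (m * n) = 1) :
    (a : ZMod (m * n)) * (a : ZMod (m * n))⁻¹ = 1 := by
  apply ZMod.coe_int_mul_inv_eq_one
  rwa [Int.isCoprime_iff_gcd_eq_one, Nat.cast_mul]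

theorem not_dvd_of_gcd_eq_one {m n p : ℕ} {a : ℤ} (hp : p.Prime) (hpm : p ∣ m)
    (h : Int.gcd a (m * n) = 1) : ¬ (p : ℤ) ∣ a := fun ha => by
  have hpn : (p : ℤ) ∣ (m * n : ℤ) := (Int.natCast_dvd_natCast.mpr hpm).mul_right _
  have := Int.dvd_coe_gcd ha hpn
  rw [h] at this
  exact hp.one_lt.ne' (by exact_mod_cast Int.natCast_dvd_natCast.mp this |> Nat.dvd_one.mp)

/-- For a solution of the conditions, `∑ vᵢ` vanishes modulo the radical; at the prime `2` this
uses that the number of variables is even. -/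
theorem N2cond.rad_dvd_sum {ρ : ℕ} {b : Fin 4 → ℤ} {u : ℤ} {v : Fin 4 → ℤ}
    (h : N2cond ρ b u v) (hu : Int.gcd u (ρ * rad ρ) = 1)
    (hv : ∀ i, Int.gcd (v i) (ρ * rad ρ) = 1) : (rad ρ : ℤ) ∣ ∑ i, v i := by
  refine rad_intCast_dvd fun p hp hpρ => ?_
  obtain rfl | hp2 := eq_or_ne p 2
  · have hodd i := not_dvd_of_gcd_eq_one hp hpρ (hv i)
    have h0 := hodd 0
    have h1 := hodd 1
    have h2 := hodd 2
    have h3 := hodd 3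
    rw [Fin.sum_univ_four]
    push_cast at *
    omega
  obtain ⟨hsum, hcong⟩ := h
  simp only [castHom_eq_castHom_iff] at hcong
  choose k hk using hcong
  obtain ⟨K, hK⟩ := ZMod.intCast_surjective (∑ i, k i)
  have hzero : ((2 * u * ∑ i, v i - ρ * K : ℤ) : ZMod (ρ * rad ρ)) = 0 := by
    push_cast
    rw [hK, ← hsum, Finset.mul_sum, Finset.mul_sum, ← Finset.sum_sub_distrib]
    exact Finset.sum_congr rfl fun i _ => by linear_combination hk i
  have hpρ' : (p : ℤ) ∣ ρ := Int.natCast_dvd_natCast.mpr hpρ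
  have hdvd : (p : ℤ) ∣ 2 * u * ∑ i, v i := by
    rw [← dvd_sub_left (hpρ'.mul_right K)]
    exact (Int.natCast_dvd_natCast.mpr (hpρ.mul_right _)).trans
      ((ZMod.intCast_zmod_eq_zero_iff_dvd _ _).mp hzero)
  have hpp := Nat.prime_iff_prime_int.mp hp
  refine (hpp.dvd_or_dvd hdvd).resolve_left fun h2u => ?_
  refine (hpp.dvd_or_dvd h2u).elim (fun h2 => hp2 ?_) (not_dvd_of_gcd_eq_one hp hpρ hu)
  exact (Nat.prime_dvd_prime_iff_eq hp Nat.prime_two).mp (by exact_mod_cast h2)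

theorem N2cond.congr {ρ : ℕ} {b : Fin 4 → ℤ} {u u' : ℤ} {v v' : Fin 4 → ℤ}
    (h : N2cond ρ b u v) (hu : Int.gcd u (ρ * rad ρ) = 1)
    (hv : ∀ i, Int.gcd (v i) (ρ * rad ρ) = 1) (hv' : ∀ i, Int.gcd (v' i) (ρ * rad ρ) = 1)
    (huu : u ≡ u' [ZMOD (ρ : ℤ)]) (hvv : ∀ i, v i ≡ v' i [ZMOD (ρ : ℤ)]) :
    N2cond ρ b u' v' := by
  have hr := natCast_sq_eq_zero_mul_rad ρ
  have hrsum : (ρ : ZMod (ρ * rad ρ)) * ∑ i, (v i : ZMod (ρ * rad ρ)) = 0 := by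
    have : ((ρ * ∑ i, v i : ℤ) : ZMod (ρ * rad ρ)) = 0 := by
      rw [ZMod.intCast_zmod_eq_zero_iff_dvd, Nat.cast_mul]
      exact mul_dvd_mul_left _ (h.rad_dvd_sum hu hv)
    exact_mod_cast this
  obtain ⟨hsum, hcong⟩ := h
  obtain ⟨s, hs⟩ := exists_intCast_eq_add_mul (ρ * rad ρ) huu
  choose t ht using fun i => exists_intCast_eq_add_mul (ρ * rad ρ) (hvv i)
  have hw i := mul_inv_eq_one_of_gcd_eq_one (hv i)
  have hw' i := mul_inv_eq_one_of_gcd_eq_one (hv' i)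
  simp only [N2cond, castHom_eq_castHom_iff] at hcong ⊢
  choose k hk using hcong
  generalize (ρ : ZMod (ρ * rad ρ)) = r at *
  have hinv i : (v' i : ZMod (ρ * rad ρ))⁻¹ =
      (v i : ZMod (ρ * rad ρ))⁻¹ - (v i : ZMod (ρ * rad ρ))⁻¹ ^ 2 * (r * t i) := by
    have hone : (v' i : ZMod (ρ * rad ρ)) *
        ((v i : ZMod (ρ * rad ρ))⁻¹ - (v i : ZMod (ρ * rad ρ))⁻¹ ^ 2 * (r * t i)) = 1 := by
      rw [ht]
      linear_combination (1 - (v i : ZMod (ρ * rad ρ))⁻¹ * r * t i) * hw i -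
        (v i : ZMod (ρ * rad ρ))⁻¹ ^ 2 * t i ^ 2 * hr
    exact left_inv_eq_right_inv ((mul_comm _ _).trans (hw' i)) hone
  simp only [hinv]
  simp only [hs, ht]
  constructor
  · rw [← hsum, ← sub_eq_zero, ← Finset.sum_sub_distrib, ← mul_zero s, ← hrsum,
      Finset.mul_sum, Finset.mul_sum]
    refine Finset.sum_congr rfl fun i _ => ?_
    linear_combination (s * t i + (v i : ZMod (ρ * rad ρ))⁻¹ * t i * k i) * hr -
      u * r * t i * hw i + r * t i * (v i : ZMod (ρ * rad ρ))⁻¹ * hk i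
  · intro i
    refine ⟨k i + u * t i + s * v i + r * s * t i +
      (b i : ZMod (ρ * rad ρ))⁻¹ * (v i : ZMod (ρ * rad ρ))⁻¹ ^ 2 * t i, ?_⟩
    linear_combination hk i

/-- The conditions defining `N₂(ρ)` depend only on the residues of `u, u₁, …, u₄` mod `ρ`. -/
theorem N2cond_well_defined (ρ : ℕ) (hρ : 1 ≤ ρ) (b : Fin 4 → ℤ)
    (hb : ∀ i, Int.gcd (b i) ρ = 1) (u u' : ℤ) (v v' : Fin 4 → ℤ)
    (hu : Int.gcd u (ρ * rad ρ) = 1) (hu' : Int.gcd u' (ρ * rad ρ) = 1)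
    (hv : ∀ i, Int.gcd (v i) (ρ * rad ρ) = 1) (hv' : ∀ i, Int.gcd (v' i) (ρ * rad ρ) = 1)
    (huu : u ≡ u' [ZMOD (ρ : ℤ)]) (hvv : ∀ i, v i ≡ v' i [ZMOD (ρ : ℤ)]) :
    N2cond ρ b u v ↔ N2cond ρ b u' v' := by
  exact ⟨fun h => h.congr hu hv hv' huu hvv,
    fun h => h.congr hu' hv' hv huu.symm fun i => (hvv i).symm⟩
end
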